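/- arXiv:1703.03756 — 5 statements merged into one kernel-verified Lean document; each statement's English description precedes it below -/
import Mathlib

section
/- Every finite graph G admits a lean tree-decomposition of width tw(G). -/
open scoped Classical

noncomputable section

/-- An oriented separation of `V`: an ordered pair of subsets. -/
abbrev OSep (V : Type*) := Set V × Set V

namespace OSep

/-- The involution `(A,B)* = (B,A)`. -/
def flip {V : Type*} (s : OSep V) : OSep V := (s.2, s.1)

/-- The partial order `(A,B) ≤ (C,D) iff A ⊆ C and D ⊆ B`. -/
def le {V : Type*} (s t : OSep V) : Prop := s.1 ⊆ t.1 ∧ t.2 ⊆ s.2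

/-- The infimum `(A,B) ∧ (C,D) = (A ∩ C, B ∪ D)`. -/
def inter {V : Type*} (s t : OSep V) : OSep V := (s.1 ∩ t.1, s.2 ∪ t.2)

/-- The supremum `(A,B) ∨ (C,D) = (A ∪ C, B ∩ D)`. -/
def union {V : Type*} (s t : OSep V) : OSep V := (s.1 ∪ t.1, s.2 ∩ t.2)

end OSep

/-- A universe of set separations: a set of oriented separations (pairs covering `V`)
closed under the involution and under ∧ and ∨. -/
structure IsUniverse {V : Type*} (S : Set (OSep V)) : Prop where
  covers : ∀ s ∈ S, s.1 ∪ s.2 = Set.univ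
  flip_mem : ∀ s ∈ S, s.flip ∈ S
  inter_mem : ∀ s ∈ S, ∀ t ∈ S, s.inter t ∈ S
  union_mem : ∀ s ∈ S, ∀ t ∈ S, s.union t ∈ S

/-- An order function on a universe `S`: symmetric and submodular (non-negativity is
automatic for `ℕ`-valued functions). -/
structure IsOrderFun {V : Type*} (S : Set (OSep V)) (ord : OSep V → ℕ) : Prop where
  symm : ∀ s ∈ S, ord s.flip = ord s
  submod : ∀ s ∈ S, ∀ t ∈ S, ord (s.inter t) + ord (s.union t) ≤ ord s + ord t

/-- A universe with an order function is grounded if `|A ∪ C, B ∩ D| ≤ |C,D|`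
whenever `(B,A) ≤ (C,D)`. -/
def Grounded {V : Type*} (S : Set (OSep V)) (ord : OSep V → ℕ) : Prop :=
  ∀ s ∈ S, ∀ t ∈ S, OSep.le s.flip t → ord (s.union t) ≤ ord t

/-- A submodular function on subsets of `V`. -/
def Submodular {V : Type*} (r : Set V → ℕ) : Prop :=
  ∀ X Y : Set V, r (X ∩ Y) + r (X ∪ Y) ≤ r X + r Y

/-- The order function `|X,Y|_r = r(X) + r(Y) - r(V)` induced by `r`. -/
def ordOf {V : Type*} (r : Set V → ℕ) (s : OSep V) : ℕ := r s.1 + r s.2 - r Set.univ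

/-- A multiset of oriented separations is a star if `(A,B) ≤ (D,C)` for every two of its
members occupying distinct positions. -/
def IsStar {V : Type*} (σ : Multiset (OSep V)) : Prop :=
  ∀ a b : OSep V, (a ::ₘ {b}) ≤ σ → OSep.le a b.flip

/-- The size `⟨σ⟩_r = Σᵢ r(Bᵢ) − n · r(V)` of a star `σ = {(A₀,B₀),…,(Aₙ,Bₙ)}`. -/
def starSize {V : Type*} (r : Set V → ℕ) (σ : Multiset (OSep V)) : ℕ :=
  (σ.map fun s => r s.2).sum - (Multiset.card σ - 1) * r Set.univ

/-- `λ((A,B),(C,D)) = min { |X,Y| : (X,Y) ∈ S, (A,B) ≤ (X,Y) ≤ (C,D) }`. -/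
def lam {V : Type*} (S : Set (OSep V)) (ord : OSep V → ℕ) (a c : OSep V) : ℕ :=
  sInf (ord '' {s | s ∈ S ∧ OSep.le a s ∧ OSep.le s c})

/-- `(X,Y)` is linked to `(A,B)` if `(A,B) ≤ (X,Y)` and `|X,Y| = λ((A,B),(X,Y))`. -/
def IsLinkedSep {V : Type*} (S : Set (OSep V)) (ord : OSep V → ℕ) (a x : OSep V) : Prop :=
  x ∈ S ∧ OSep.le a x ∧ ord x = lam S ord a x

/-- `σ_t`: the multiset of labels of the oriented edges (darts) pointing towards `t`. -/
def starAt {W : Type*} [Fintype W] {V : Type*} (T : SimpleGraph W) (α : T.Dart → OSep V)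
    (t : W) : Multiset (OSep V) :=
  ((Finset.univ : Finset T.Dart).filter fun d => d.toProd.2 = t).val.map α

/-- The natural ordering on the oriented edges (darts) of a tree: `d ≤ d'` iff both lie
(in that direction) on the path from the tail of `d` to the head of `d'`. -/
def dartLE {W : Type*} (T : SimpleGraph W) (d d' : T.Dart) : Prop :=
  ∀ p : T.Walk d.toProd.1 d'.toProd.2, p.IsPath → d ∈ p.darts ∧ d' ∈ p.darts

/-- The vertex set of the subtree `T(e⃗)`: the component of `T - x` containing `y` together
with `x` itself, for `e⃗ = (x,y)`. -/
def shiftSet {W : Type*} (T : SimpleGraph W) (e : T.Dart) : Set W :=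
  {v | v = e.toProd.1 ∨ ∀ p : T.Walk e.toProd.1 v, p.IsPath → e ∈ p.darts}

/-- A dart of an induced subgraph, as a dart of the ambient graph. -/
def liftDart {W : Type*} {T : SimpleGraph W} {U : Set W} (d : (T.induce U).Dart) : T.Dart :=
  ⟨(d.toProd.1.val, d.toProd.2.val), d.adj⟩

/-- The labelling `α'` of the shift of `(T,α)` onto `(X,Y)` with respect to `e⃗`:
a dart `f` of `T(e⃗)` with `e⃗ ≤ f⃗` gets `α(f⃗) ∨ (X,Y)`, and the reverse darts get the
flipped labels. -/
def shiftAlpha {W : Type*} {V : Type*} (T : SimpleGraph W) (α : T.Dart → OSep V)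
    (e : T.Dart) (X : OSep V) : (T.induce (shiftSet T e)).Dart → OSep V :=
  fun d =>
    if dartLE T e (liftDart d) then (α (liftDart d)).union X
    else ((α (liftDart d).symm).union X).flip

/-- A family `F` of stars is fixed under shifting if for every tame `S`-tree `(T,α)`,
every oriented edge `e⃗ = (t,t')` of `T`, every vertex `s ≠ t` of `T(e⃗)` with
`α(F⃗_s) ∈ F`, and every `(X,Y)` linked to `α(e⃗)`, in the shift of `(T,α)` onto `(X,Y)`
with respect to `e⃗` one has `α'(F⃗_s) ∈ F`. -/
def FixedUnderShifting {V : Type*} (S : Set (OSep V)) (ord : OSep V → ℕ)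
    (F : Set (Multiset (OSep V))) : Prop :=
  ∀ (n : ℕ) (T : SimpleGraph (Fin n)) (α : T.Dart → OSep V) (e : T.Dart) (X : OSep V)
    (s : ↥(shiftSet T e)),
    T.IsTree → (∀ d, α d.symm = (α d).flip) → (∀ d, α d ∈ S) →
    (∀ t, IsStar (starAt T α t)) →
    (s : Fin n) ≠ e.toProd.1 → starAt T α (s : Fin n) ∈ F →
    IsLinkedSep S ord (α e) X →
    starAt (T.induce (shiftSet T e)) (shiftAlpha T α e X) s ∈ F

/-- A linked `S_k`-tree: for every two darts `e⃗ ≤ f⃗`, the minimum order of a label on the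
path from `e` to `f` equals `λ(α(e⃗), α(f⃗))`. -/
def IsLinkedTree {W : Type*} {V : Type*} (S : Set (OSep V)) (ord : OSep V → ℕ)
    (T : SimpleGraph W) (α : T.Dart → OSep V) : Prop :=
  ∀ e f : T.Dart, dartLE T e f →
    sInf ((fun g => ord (α g)) '' {g | dartLE T e g ∧ dartLE T g f}) =
      lam S ord (α e) (α f)

/-- An `F`-lean `S_k`-tree with respect to the ground function `r`. -/
def IsLeanTree {W : Type*} [Fintype W] {V : Type*} (S : Set (OSep V)) (ord : OSep V → ℕ)
    (r : Set V → ℕ) (T : SimpleGraph W) (α : T.Dart → OSep V)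
    (F : Set (Multiset (OSep V))) : Prop :=
  ∀ (t t' : W) (a b : OSep V), OSep.le a b.flip →
    (a ::ₘ starAt T α t) ∈ F → (b ::ₘ starAt T α t') ∈ F →
    (min (r a.1) (r b.1) ≤ lam S ord a b.flip ∨
      ∀ p : T.Walk t t', p.IsPath →
        sInf ((fun d => ord (α d)) '' {d | d ∈ p.darts}) = lam S ord a b.flip)

/-- `int(σ) = ⋂ᵢ Bᵢ` for `σ = {(A₀,B₀),…,(Aₙ,Bₙ)}`. -/
def intStar {V : Type*} (σ : Multiset (OSep V)) : Set V := {v | ∀ s ∈ σ, v ∈ s.2}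

/-- The universe of oriented separations of a graph `G`: pairs `(A,B)` of vertex sets with
`A ∪ B = V(G)` and no edge between `A ∖ B` and `B ∖ A`. -/
def graphSeps {V : Type*} (G : SimpleGraph V) : Set (OSep V) :=
  {s | s.1 ∪ s.2 = Set.univ ∧ ∀ a ∈ s.1 \ s.2, ∀ b ∈ s.2 \ s.1, ¬ G.Adj a b}

/-- `G` contains `k` vertex-disjoint `Z₁`–`Z₂` paths. -/
def HasDisjointPaths {V : Type*} (G : SimpleGraph V) (Z₁ Z₂ : Set V) (k : ℕ) : Prop :=
  ∃ (u v : Fin k → V) (p : ∀ i, G.Walk (u i) (v i)),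
    (∀ i, (p i).IsPath) ∧ (∀ i, u i ∈ Z₁) ∧ (∀ i, v i ∈ Z₂) ∧
    ∀ i j, i ≠ j → ∀ x, x ∈ (p i).support → x ∉ (p j).support

/-- `(T, B)` is a tree-decomposition of the graph `G`. -/
def IsTreeDecomp {V : Type*} {n : ℕ} (G : SimpleGraph V) (T : SimpleGraph (Fin n))
    (B : Fin n → Set V) : Prop :=
  T.IsTree ∧ (∀ v, ∃ t, v ∈ B t) ∧ (∀ u w, G.Adj u w → ∃ t, u ∈ B t ∧ w ∈ B t) ∧
  (∀ t₁ t₂ t₃ : Fin n, ∀ p : T.Walk t₁ t₃, p.IsPath → t₂ ∈ p.support → B t₁ ∩ B t₃ ⊆ B t₂)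

/-- The width of a tree-decomposition: `max |V_t| − 1`. -/
def tdWidth {V : Type*} {n : ℕ} (B : Fin n → Set V) : ℕ :=
  (Finset.univ.sup fun t => (B t).ncard) - 1

/-- The tree-width of a graph. -/
def treeWidth {V : Type*} (G : SimpleGraph V) : ℕ :=
  sInf {w | ∃ (n : ℕ) (T : SimpleGraph (Fin n)) (B : Fin n → Set V),
    IsTreeDecomp G T B ∧ tdWidth B = w}

/-- The path-width of a graph: minimum width of a tree-decomposition whose tree is a path. -/
def pathWidth {V : Type*} (G : SimpleGraph V) : ℕ :=
  sInf {w | ∃ (n : ℕ) (B : Fin n → Set V),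
    IsTreeDecomp G (SimpleGraph.pathGraph n) B ∧ tdWidth B = w}

/-- A linked tree-decomposition of a graph. -/
def IsLinkedDecomp {V : Type*} {n : ℕ} (G : SimpleGraph V) (T : SimpleGraph (Fin n))
    (B : Fin n → Set V) : Prop :=
  ∀ (k : ℕ) (t t' : Fin n),
    HasDisjointPaths G (B t) (B t') k ∨
    ∀ p : T.Walk t t', p.IsPath →
      ∃ d ∈ p.darts, (B d.toProd.1 ∩ B d.toProd.2).ncard < k

/-- A lean tree-decomposition of a graph. -/
def IsLeanDecomp {V : Type*} {n : ℕ} (G : SimpleGraph V) (T : SimpleGraph (Fin n))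
    (B : Fin n → Set V) : Prop :=
  ∀ (k : ℕ) (t t' : Fin n) (Z₁ Z₂ : Set V), Z₁ ⊆ B t → Z₂ ⊆ B t' →
    Z₁.ncard = k → Z₂.ncard = k →
    HasDisjointPaths G Z₁ Z₂ k ∨
    ∀ p : T.Walk t t', p.IsPath →
      ∃ d ∈ p.darts, (B d.toProd.1 ∩ B d.toProd.2).ncard < k
/-- The rank function of a matroid: `r(X)` is the maximum size of an independent subset
of `X`. -/
def mRank {α : Type*} (M : Matroid α) (X : Set α) : ℕ :=
  sSup {k | ∃ I, I ⊆ X ∧ M.Indep I ∧ I.ncard = k}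

/-- The connectivity `λ(X) = r(X) + r(E ∖ X) − r(E)` of `X ⊆ E`. -/
def mConn {α : Type*} (M : Matroid α) (X : Set α) : ℕ :=
  mRank M X + mRank M Xᶜ - mRank M Set.univ

/-- For a dart `d = (s,s')` of a tree `T`, the component of `T − s'` containing `s`. -/
def branch {W : Type*} (T : SimpleGraph W) (d : T.Dart) : Set W :=
  {w | ∀ p : T.Walk d.toProd.2 w, p.IsPath → d.toProd.1 ∈ p.support}

/-- The darts of `T` pointing towards `t`. -/
def dartsTo {W : Type*} [Fintype W] (T : SimpleGraph W) (t : W) : Finset T.Dart :=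
  Finset.univ.filter fun d => d.toProd.2 = t

/-- The width `Σᵢ r(E ∖ τ⁻¹(Tᵢ)) − (d−1)·r(E)` of the bag of a matroid tree-decomposition
at `v`, where the `Tᵢ` are the components of `T − v`. -/
def mBagWidth {α : Type*} {n : ℕ} (M : Matroid α) (T : SimpleGraph (Fin n))
    (τ : α → Fin n) (v : Fin n) : ℕ :=
  ((∑ d ∈ dartsTo T v, mRank M ((τ ⁻¹' branch T d)ᶜ)) + mRank M Set.univ)
    - (dartsTo T v).card * mRank M Set.univ

/-- The width of a matroid tree-decomposition: the maximum width of a bag. -/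
def mWidth {α : Type*} {n : ℕ} (M : Matroid α) (T : SimpleGraph (Fin n))
    (τ : α → Fin n) : ℕ :=
  Finset.univ.sup (mBagWidth M T τ)

/-- The tree-width of a matroid. -/
def matroidTreeWidth {α : Type*} (M : Matroid α) : ℕ :=
  sInf {w | ∃ (n : ℕ) (T : SimpleGraph (Fin n)) (_ : T.IsTree) (τ : α → Fin n),
    mWidth M T τ = w}

/-- `λ(Z₁,Z₂) = min {λ(X) : Z₁ ⊆ X ⊆ E ∖ Z₂}` for disjoint `Z₁, Z₂ ⊆ E`. -/
def mLam {α : Type*} (M : Matroid α) (Z₁ Z₂ : Set α) : ℕ :=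
  sInf (mConn M '' {X | Z₁ ⊆ X ∧ X ⊆ Z₂ᶜ})

/-- A lean matroid tree-decomposition. -/
def IsLeanMDecomp {α : Type*} {n : ℕ} (M : Matroid α) (T : SimpleGraph (Fin n))
    (τ : α → Fin n) : Prop :=
  ∀ (k : ℕ) (t t' : Fin n) (Z₁ Z₂ : Set α), Z₁ ⊆ τ ⁻¹' {t} → Z₂ ⊆ τ ⁻¹' {t'} →
    Disjoint Z₁ Z₂ → mRank M Z₁ = k → mRank M Z₂ = k →
    k ≤ mLam M Z₁ Z₂ ∨
    ∀ p : T.Walk t t', p.IsPath → ∃ d ∈ p.darts, mConn M (τ ⁻¹' branch T d) < k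

/-- A linked matroid tree-decomposition. -/
def IsLinkedMDecomp {α : Type*} {n : ℕ} (M : Matroid α) (T : SimpleGraph (Fin n))
    (τ : α → Fin n) : Prop :=
  ∀ e f : T.Dart, dartLE T e f →
    sInf ((fun g => mConn M (τ ⁻¹' branch T g)) '' {g | dartLE T e g ∧ dartLE T g f}) =
      sInf (mConn M '' {X | τ ⁻¹' branch T e ⊆ X ∧ X ⊆ τ ⁻¹' branch T f})
/-- Two oriented separations are nested if they have `≤`-comparable orientations. -/
def Nested {V : Type*} (s t : OSep V) : Prop :=
  OSep.le s t ∨ OSep.le s t.flip ∨ OSep.le s.flip t ∨ OSep.le s.flip t.flip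

section Menger

variable {V : Type*} {G : SimpleGraph V} {A B Z₁ Z₂ : Set V} {k : ℕ}

lemma mem_graphSeps_iff :
    (A, B) ∈ graphSeps G ↔ (∀ v, v ∈ A ∨ v ∈ B) ∧
      ∀ u w, G.Adj u w → (u ∈ A ∧ w ∈ A) ∨ (u ∈ B ∧ w ∈ B) := by
  simp only [graphSeps, Set.mem_ofPred_eq, Set.eq_univ_iff_forall, Set.mem_union, Set.mem_sdiff]
  constructor
  · rintro ⟨h1, h2⟩
    refine ⟨h1, fun u w huw => ?_⟩
    have := h2 u
    have := h2 w
    have := huw.symm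
    have := h1 u
    have := h1 w
    grind
  · rintro ⟨h1, h2⟩
    refine ⟨h1, fun u hu w hw huw => ?_⟩
    have := h2 u w huw
    grind

lemma graphSeps_swap (h : (A, B) ∈ graphSeps G) : (B, A) ∈ graphSeps G := by
  rw [mem_graphSeps_iff] at h ⊢
  exact ⟨fun v => (h.1 v).symm, fun u w huw => (h.2 u w huw).symm⟩

lemma graphSeps_corner {C D : Set V} (h : (A, B) ∈ graphSeps G) (h' : (C, D) ∈ graphSeps G) :
    (A ∪ C, B ∩ D) ∈ graphSeps G := by
  rw [mem_graphSeps_iff] at h h' ⊢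
  refine ⟨fun v => ?_, fun u w huw => ?_⟩
  · have := h.1 v
    have := h'.1 v
    simp only [Set.mem_union, Set.mem_inter_iff]
    tauto
  · have := h.2 u w huw
    have := h'.2 u w huw
    simp only [Set.mem_union, Set.mem_inter_iff]
    tauto

lemma HasDisjointPaths.symm (h : HasDisjointPaths G Z₁ Z₂ k) : HasDisjointPaths G Z₂ Z₁ k := by
  obtain ⟨u, v, p, hp, hu, hv, hd⟩ := h
  exact ⟨v, u, fun i => (p i).reverse, fun i => (hp i).reverse, hv, hu, fun i j hij x => by
    simpa using hd i j hij x⟩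

/-- Walks may be shortened to paths. -/
lemma hasDisjointPaths_of_walks (u v : Fin k → V) (p : ∀ i, G.Walk (u i) (v i))
    (hu : ∀ i, u i ∈ Z₁) (hv : ∀ i, v i ∈ Z₂)
    (hd : ∀ i j, i ≠ j → ∀ x, x ∈ (p i).support → x ∉ (p j).support) :
    HasDisjointPaths G Z₁ Z₂ k :=
  ⟨u, v, fun i => (p i).bypass, fun i => (p i).bypass_isPath, hu, hv, fun i j hij x hx hx' =>
    hd i j hij x ((p i).support_bypass_subset_support hx)
      ((p j).support_bypass_subset_support hx')⟩

lemma HasDisjointPaths.mono_graph {G' : SimpleGraph V} (hG : G ≤ G')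
    (h : HasDisjointPaths G Z₁ Z₂ k) : HasDisjointPaths G' Z₁ Z₂ k := by
  obtain ⟨u, v, p, hp, hu, hv, hd⟩ := h
  exact hasDisjointPaths_of_walks u v (fun i => (p i).mapLe hG) hu hv fun i j hij x => by
    simpa using hd i j hij x

/-- A walk crossing a separation meets the separator. -/
lemma exists_mem_support_inter (h : (A, B) ∈ graphSeps G) {a b : V} (p : G.Walk a b)
    (ha : a ∈ A) (hb : b ∈ B) : ∃ x ∈ p.support, x ∈ A ∩ B := by
  induction p with
  | nil => exact ⟨_, by simp, ha, hb⟩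
  | @cons u v w huv p ih =>
    by_cases hu : u ∈ B
    · exact ⟨u, by simp, ha, hu⟩
    · have hv : v ∈ A := by
        rcases (mem_graphSeps_iff.1 h).2 u v huv with h | h
        · exact h.2
        · exact absurd h.1 hu
      obtain ⟨x, hx, hx'⟩ := ih hv hb
      exact ⟨x, by simp [hx], hx'⟩

/-- A path starting in `A` that meets `A ∩ B` at most in its last vertex stays in `A`. -/
lemma support_subset_of_isPath (h : (A, B) ∈ graphSeps G) {a b : V} (p : G.Walk a b)
    (hp : p.IsPath) (ha : a ∈ A) (hS : ∀ x ∈ p.support, x ∈ A ∩ B → x = b) :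
    ∀ x ∈ p.support, x ∈ A := by
  induction p with
  | nil => simpa using ha
  | @cons u v w huv p ih =>
    rw [SimpleGraph.Walk.cons_isPath_iff] at hp
    have huB : u ∉ B := fun hu => by
      have := hS u (by simp) ⟨ha, hu⟩
      exact hp.2 (this ▸ p.end_mem_support)
    have hv : v ∈ A := by
      rcases (mem_graphSeps_iff.1 h).2 u v huv with h | h
      · exact h.2
      · exact absurd h.1 huB
    intro x hx
    rw [SimpleGraph.Walk.support_cons, List.mem_cons] at hx
    rcases hx with rfl | hx
    · exact ha
    · exact ih hp.1 hv (fun x hx => hS x (by simp [hx])) x hx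

lemma HasDisjointPaths.le_ncard_inter [Finite V] (hd : HasDisjointPaths G Z₁ Z₂ k)
    (h : (A, B) ∈ graphSeps G) (h1 : Z₁ ⊆ A) (h2 : Z₂ ⊆ B) : k ≤ (A ∩ B).ncard := by
  obtain ⟨u, v, p, hp, hu, hv, hd⟩ := hd
  choose f hf hf' using fun i => exists_mem_support_inter h (p i) (h1 (hu i)) (h2 (hv i))
  have hinj : Function.Injective f := fun i j hij => by
    by_contra hne
    exact hd i j hne _ (hf i) (hij ▸ hf j)
  have : (Set.range f).ncard = k := by
    rw [← Set.image_univ, Set.ncard_image_of_injective _ hinj, Set.ncard_univ, Nat.card_fin]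
  rw [← this]
  exact Set.ncard_le_ncard (by rintro _ ⟨i, rfl⟩; exact hf' i)

/-- An injection from `Fin k` into a set of size `k` hits every element. -/
lemma exists_eq_of_injective_of_ncard [Finite V] {S : Set V} {f : Fin k → V}
    (hf : Function.Injective f) (hS : ∀ i, f i ∈ S) (hk : S.ncard = k) {z : V} (hz : z ∈ S) :
    ∃ i, f i = z := by
  have h : (Set.range f).ncard = k := by
    rw [← Set.image_univ, Set.ncard_image_of_injective _ hf, Set.ncard_univ, Nat.card_fin]
  have : Set.range f = S :=
    Set.eq_of_subset_of_ncard_le (by rintro _ ⟨i, rfl⟩; exact hS i) (by rw [h, hk])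
  rwa [← this] at hz

/-- Linkages on the two sides of a separation of `G - xy`, ending in `S ∪ {x}` and starting in
`S ∪ {y}` respectively, can be joined along `S` and the edge `xy`. -/
lemma HasDisjointPaths.join [Finite V] {G' : SimpleGraph V} (hG : G' ≤ G) {C D : Set V}
    (hCD : (C, D) ∈ graphSeps G') (h1 : Z₁ ⊆ C) (h2 : Z₂ ⊆ D) {x y : V} (hxy : G.Adj x y)
    (hx : x ∈ C) (hy : y ∈ D) (hyC : y ∉ C)
    (hkx : (insert x (C ∩ D)).ncard = k) (hky : (insert y (C ∩ D)).ncard = k)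
    (hP : HasDisjointPaths G' Z₁ (insert x (C ∩ D)) k)
    (hQ : HasDisjointPaths G' (insert y (C ∩ D)) Z₂ k) : HasDisjointPaths G Z₁ Z₂ k := by
  obtain ⟨u, v, p, hp, hu, hv, hd⟩ := hP
  obtain ⟨u', v', q, hq, hu', hv', hd'⟩ := hQ
  have vinj : Function.Injective v := fun i j hij => by
    by_contra hne
    exact hd i j hne _ (p i).end_mem_support (by rw [hij]; exact (p j).end_mem_support)
  have uinj : Function.Injective u' := fun i j hij => by
    by_contra hne
    exact hd' i j hne _ (q i).start_mem_support (by rw [hij]; exact (q j).start_mem_support)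
  have hpv : ∀ i, ∀ z ∈ (p i).support, z ∈ insert x (C ∩ D) → z = v i := by
    intro i z hz hzS
    obtain ⟨j, rfl⟩ := exists_eq_of_injective_of_ncard vinj hv hkx hzS
    by_contra hne
    exact hd i j (fun h => hne (h ▸ rfl)) _ hz (p j).end_mem_support
  have hqu : ∀ i, ∀ z ∈ (q i).support, z ∈ insert y (C ∩ D) → z = u' i := by
    intro i z hz hzS
    obtain ⟨j, rfl⟩ := exists_eq_of_injective_of_ncard uinj hu' hky hzS
    by_contra hne
    exact hd' i j (fun h => hne (h ▸ rfl)) _ hz (q j).start_mem_support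
  have hpC : ∀ i, ∀ z ∈ (p i).support, z ∈ C := fun i =>
    support_subset_of_isPath hCD (p i) (hp i) (h1 (hu i))
      fun z hz hzS => hpv i z hz (Set.mem_insert_of_mem _ hzS)
  have hqD : ∀ i, ∀ z ∈ (q i).support, z ∈ D := fun i z hz =>
    support_subset_of_isPath (graphSeps_swap hCD) (q i).reverse (hq i).reverse (h2 (hv' i))
      (fun z hz hzS => hqu i z (by simpa using hz) (Set.mem_insert_of_mem _ hzS.symm)) z
      (by simpa using hz)
  have key : ∀ i, ∃ j, (v i = u' j ∨ (v i = x ∧ u' j = y)) ∧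
      ∃ w : G.Walk (u i) (v' j), ∀ z ∈ w.support, z ∈ (p i).support ∨ z ∈ (q j).support := by
    intro i
    rcases Set.mem_insert_iff.1 (hv i) with h | h
    · obtain ⟨j, hj⟩ := exists_eq_of_injective_of_ncard uinj hu' hky (Set.mem_insert y _)
      refine ⟨j, Or.inr ⟨h, hj⟩, ((p i).mapLe hG).append
        (.cons (by rw [h, hj]; exact hxy) ((q j).mapLe hG)), fun z hz => ?_⟩
      rw [SimpleGraph.Walk.mem_support_append_iff] at hz
      rcases hz with hz | hz
      · left; simpa using hz
      · rw [SimpleGraph.Walk.support_cons, List.mem_cons] at hz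
        rcases hz with rfl | hz
        · left; simp
        · right; simpa using hz
    · obtain ⟨j, hj⟩ := exists_eq_of_injective_of_ncard uinj hu' hky (Set.mem_insert_of_mem y h)
      refine ⟨j, Or.inl hj.symm, ((p i).mapLe hG).append
        (((q j).mapLe hG).copy hj rfl), fun z hz => ?_⟩
      rw [SimpleGraph.Walk.mem_support_append_iff] at hz
      simpa using hz
  choose j hj w hw using key
  have jinj : Function.Injective j := by
    intro a b hab
    apply vinj
    have ha := hj a
    have hb := hj b
    rw [← hab] at hb
    have hv1 := hv a
    have hv2 := hv b
    grind
  have cross : ∀ a b, ∀ z, z ∈ (p a).support → z ∈ (q (j b)).support → a = b := by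
    intro a b z hz hz'
    have hzS : z ∈ C ∩ D := ⟨hpC a z hz, hqD _ z hz'⟩
    have e1 := hpv a z hz (Set.mem_insert_of_mem _ hzS)
    have e2 := hqu _ z hz' (Set.mem_insert_of_mem _ hzS)
    apply vinj
    have := hj b
    grind
  refine hasDisjointPaths_of_walks u (fun i => v' (j i)) w hu (fun i => hv' _) ?_
  intro a b hab z hz hz'
  rcases hw a z hz with h | h <;> rcases hw b z hz' with h' | h'
  · exact hd a b hab z h h'
  · exact hab (cross a b z h h')
  · exact hab (cross b a z h' h).symm
  · exact hd' _ _ (fun h => hab (jinj h)) z h h'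

/-- **Menger's theorem** for vertex sets, in terms of separations. -/
theorem hasDisjointPaths_of_forall_le [Finite V] (G : SimpleGraph V) :
    ∀ Z₁ Z₂ : Set V, (∀ A B, (A, B) ∈ graphSeps G → Z₁ ⊆ A → Z₂ ⊆ B → k ≤ (A ∩ B).ncard) →
      HasDisjointPaths G Z₁ Z₂ k := by
  induction G using WellFoundedLT.induction with
  | ind G ih =>
  intro Z₁ Z₂ hk
  by_cases hE : G = ⊥
  · subst hE
    have h := hk Z₁ (Z₁ᶜ ∪ Z₂) (mem_graphSeps_iff.2 ⟨fun v => by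
      by_cases hv : v ∈ Z₁ <;> simp [hv], fun u w h => h.elim⟩) subset_rfl
      Set.subset_union_right
    have e : Z₁ ∩ (Z₁ᶜ ∪ Z₂) = Z₁ ∩ Z₂ := by ext; simp; tauto
    rw [e] at h
    obtain ⟨S, hS, hSk⟩ := Set.exists_subset_card_eq h
    have hcard : Nat.card S = k := hSk
    let f : Fin k ≃ S := (Finite.equivFinOfCardEq hcard).symm
    refine hasDisjointPaths_of_walks (fun i => (f i : V)) (fun i => (f i : V)) (fun i => .nil)
      (fun i => (hS (f i).2).1) (fun i => (hS (f i).2).2) fun i j hij x hx hx' => hij ?_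
    rw [SimpleGraph.Walk.mem_support_nil_iff] at hx hx'
    exact f.injective (Subtype.ext (hx.symm.trans hx'))
  · obtain ⟨x, y, hxy⟩ := SimpleGraph.ne_bot_iff_exists_adj.1 hE
    set G' := G.deleteEdges {s(x, y)} with hG'
    have hle : G' ≤ G := G.deleteEdges_le _
    have hadj : ∀ u w, G.Adj u w → G'.Adj u w ∨ (u = x ∧ w = y) ∨ (u = y ∧ w = x) := by
      intro u w h
      rw [hG', SimpleGraph.deleteEdges_adj]
      simp only [Set.mem_singleton_iff, Sym2.eq_iff]
      tauto
    have hlt : G' < G := by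
      refine lt_of_le_of_ne hle fun h => ?_
      rw [← h, hG', SimpleGraph.deleteEdges_adj] at hxy
      exact hxy.2 rfl
    by_cases hcase : ∀ A B, (A, B) ∈ graphSeps G' → Z₁ ⊆ A → Z₂ ⊆ B → k ≤ (A ∩ B).ncard
    · exact (ih G' hlt Z₁ Z₂ hcase).mono_graph hle
    push Not at hcase
    obtain ⟨C, D, hCD, h1, h2, hlt'⟩ := hcase
    have hext : ∀ A B, (A, B) ∈ graphSeps G' → ((x ∈ A ∧ y ∈ A) ∨ (x ∈ B ∧ y ∈ B)) →
        (A, B) ∈ graphSeps G := by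
      intro A B hAB hor
      rw [mem_graphSeps_iff] at hAB ⊢
      refine ⟨hAB.1, fun u w huw => ?_⟩
      rcases hadj u w huw with h | ⟨rfl, rfl⟩ | ⟨rfl, rfl⟩
      · exact hAB.2 u w h
      · exact hor
      · tauto
    have main : ∀ x y, G.Adj x y → (∀ A B, (A, B) ∈ graphSeps G' →
        ((x ∈ A ∧ y ∈ A) ∨ (x ∈ B ∧ y ∈ B)) → (A, B) ∈ graphSeps G) →
        x ∈ C → x ∉ D → y ∈ D → y ∉ C → HasDisjointPaths G Z₁ Z₂ k := by
      intro x y hxy hext hx hxD hy hyC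
      have hkx : (insert x (C ∩ D)).ncard = k := by
        apply le_antisymm
        · exact (Set.ncard_insert_le _ _).trans hlt'
        · have := hk C (D ∪ {x}) (hext _ _ ?_ (Or.inr ⟨by simp, by simp [hy]⟩)) h1
            (h2.trans Set.subset_union_left)
          · refine this.trans (Set.ncard_le_ncard ?_)
            rintro z ⟨hz, hz' | hz'⟩
            · exact Set.mem_insert_of_mem _ ⟨hz, hz'⟩
            · exact Set.mem_insert_iff.2 (Or.inl hz')
          · rw [mem_graphSeps_iff] at hCD ⊢
            refine ⟨fun v => (hCD.1 v).imp_right Or.inl, fun u w h => ?_⟩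
            exact (hCD.2 u w h).imp_right fun h => ⟨Or.inl h.1, Or.inl h.2⟩
      have hky : (insert y (C ∩ D)).ncard = k := by
        rw [← hkx, Set.ncard_insert_of_notMem (by simp [hyC]),
          Set.ncard_insert_of_notMem (by simp [hxD])]
      refine HasDisjointPaths.join hle hCD h1 h2 hxy hx hy hyC hkx hky
        (ih G' hlt _ _ fun A B hAB hA hB => ?_) (ih G' hlt _ _ fun A B hAB hA hB => ?_)
      · have hsep := graphSeps_swap (graphSeps_corner (graphSeps_swap hAB) (graphSeps_swap hCD))
        refine (hk _ _ (hext _ _ hsep (Or.inr ⟨Or.inl (hB (by simp)), Or.inr hy⟩))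
          (Set.subset_inter hA h1) (h2.trans Set.subset_union_right)).trans
          (Set.ncard_le_ncard ?_)
        rintro z ⟨⟨hzA, hzC⟩, hz | hz⟩
        · exact ⟨hzA, hz⟩
        · exact ⟨hzA, hB (Set.mem_insert_of_mem _ ⟨hzC, hz⟩)⟩
      · have hsep := graphSeps_corner hAB hCD
        refine (hk _ _ (hext _ _ hsep (Or.inl ⟨Or.inr hx, Or.inl (hA (by simp))⟩))
          (h1.trans Set.subset_union_right) (Set.subset_inter hB h2)).trans
          (Set.ncard_le_ncard ?_)
        rintro z ⟨hz | hz, hzB, hzD⟩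
        · exact ⟨hz, hzB⟩
        · exact ⟨hA (Set.mem_insert_of_mem _ ⟨hz, hzD⟩), hzB⟩
    have hno : ¬((x ∈ C ∧ y ∈ C) ∨ (x ∈ D ∧ y ∈ D)) := fun h =>
      absurd (hk C D (hext C D hCD h) h1 h2) (not_le.2 hlt')
    have hx := (mem_graphSeps_iff.1 hCD).1 x
    have hy := (mem_graphSeps_iff.1 hCD).1 y
    by_cases hxC : x ∈ C
    · exact main x y hxy hext hxC (by tauto) (by tauto) (by tauto)
    · exact main y x hxy.symm (fun A B h h' => hext A B h (by tauto)) (by tauto) (by tauto)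
        (by tauto) (by tauto)

end Menger

section TreeDecomposition

open SimpleGraph

variable {V W : Type*} {G : SimpleGraph V} {T : SimpleGraph W} {B : W → Set V}

/-- Every walk in `T` from `a` to `c` visits `b`. -/
def WalksMeet (T : SimpleGraph W) (b a c : W) : Prop := ∀ p : T.Walk a c, b ∈ p.support

lemma walksMeet_start (T : SimpleGraph W) (a c : W) : WalksMeet T a a c :=
  fun p => p.start_mem_support

lemma walksMeet_of_isPath (hT : T.IsTree) {a b c : W} {p : T.Walk a c} (hp : p.IsPath)
    (hb : b ∈ p.support) : WalksMeet T b a c := fun q => by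
  have h := (hT.existsUnique_path a c).unique hp q.bypass_isPath
  rw [h] at hb
  exact q.support_bypass_subset_support hb

lemma exists_isPath (hT : T.IsTree) (a c : W) : ∃ p : T.Walk a c, p.IsPath :=
  (hT.existsUnique_path a c).exists

/-- Tree-decompositions indexed by an arbitrary type, where the connectedness of the set of bags
containing a given vertex is expressed by walks. -/
structure IsTreeDecompOn (G : SimpleGraph V) (T : SimpleGraph W) (B : W → Set V) : Prop where
  isTree : T.IsTree
  cover : ∀ v, ∃ t, v ∈ B t
  edge : ∀ u w, G.Adj u w → ∃ t, u ∈ B t ∧ w ∈ B t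
  conn : ∀ v a c, v ∈ B a → v ∈ B c → ∃ p : T.Walk a c, ∀ x ∈ p.support, v ∈ B x

lemma isTreeDecomp_iff {n : ℕ} {T : SimpleGraph (Fin n)} {B : Fin n → Set V} :
    IsTreeDecomp G T B ↔ IsTreeDecompOn G T B := by
  constructor
  · rintro ⟨hT, hc, he, h⟩
    refine ⟨hT, hc, he, fun v a c ha hc => ?_⟩
    obtain ⟨p, hp⟩ := exists_isPath hT a c
    exact ⟨p, fun x hx => h a x c p hp hx ⟨ha, hc⟩⟩
  · rintro ⟨hT, hc, he, h⟩
    refine ⟨hT, hc, he, fun a b c p hp hb v hv => ?_⟩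
    obtain ⟨q, hq⟩ := h v a c hv.1 hv.2
    exact hq b (walksMeet_of_isPath hT hp hb q)

lemma IsTreeDecompOn.transport {W' : Type*} (h : IsTreeDecompOn G T B) (e : W' ≃ W) :
    IsTreeDecompOn G (T.comap e) (B ∘ e) where
  isTree := (Iso.comap e T).isTree_iff.2 h.isTree
  cover v := by
    obtain ⟨t, ht⟩ := h.cover v
    exact ⟨e.symm t, by simpa using ht⟩
  edge u w huw := by
    obtain ⟨t, ht⟩ := h.edge u w huw
    exact ⟨e.symm t, by simpa using ht⟩
  conn v a c ha hc := by
    obtain ⟨p, hp⟩ := h.conn v (e a) (e c) ha hc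
    have h1 : ∀ x, (Iso.comap e T).symm.toHom (e x) = x := e.symm_apply_apply
    refine ⟨(p.map (Iso.comap e T).symm.toHom).copy (h1 a) (h1 c), fun x hx => ?_⟩
    rw [Walk.support_copy, Walk.support_map, List.mem_map] at hx
    obtain ⟨y, hy, rfl⟩ := hx
    have : e ((Iso.comap e T).symm.toHom y) = y := e.apply_symm_apply y
    simpa [this] using hp y hy

/-- The vertices having a bag separated by `t` from `c` (where `t` counts as separated). -/
def farSide (T : SimpleGraph W) (B : W → Set V) (t c : W) : Set V :=
  {v | ∃ a, v ∈ B a ∧ WalksMeet T t a c}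

/-- The vertices having a bag not separated by `t` from `c`, or lying in the bag at `t`. -/
def nearSide (T : SimpleGraph W) (B : W → Set V) (t c : W) : Set V :=
  {v | ∃ a, v ∈ B a ∧ (a = t ∨ ¬WalksMeet T t a c)}

lemma bag_subset_farSide (t c : W) : B t ⊆ farSide T B t c :=
  fun _ hv => ⟨t, hv, walksMeet_start T t c⟩

lemma bag_subset_nearSide (t c : W) : B t ⊆ nearSide T B t c := fun _ hv => ⟨t, hv, Or.inl rfl⟩

lemma bag_end_subset_nearSide (t c : W) : B c ⊆ nearSide T B t c := fun v hv => by
  refine ⟨c, hv, ?_⟩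
  by_cases h : c = t
  · exact Or.inl h
  · exact Or.inr fun hm => h (by simpa [eq_comm] using hm .nil)

lemma IsTreeDecompOn.farSide_nearSide_mem (h : IsTreeDecompOn G T B) (t c : W) :
    (farSide T B t c, nearSide T B t c) ∈ graphSeps G := by
  rw [mem_graphSeps_iff]
  refine ⟨fun v => ?_, fun u w huw => ?_⟩
  · obtain ⟨a, ha⟩ := h.cover v
    by_cases hm : WalksMeet T t a c
    · exact Or.inl ⟨a, ha, hm⟩
    · exact Or.inr ⟨a, ha, Or.inr hm⟩
  · obtain ⟨a, ha, ha'⟩ := h.edge u w huw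
    by_cases hm : WalksMeet T t a c
    · exact Or.inl ⟨⟨a, ha, hm⟩, ⟨a, ha', hm⟩⟩
    · exact Or.inr ⟨⟨a, ha, Or.inr hm⟩, ⟨a, ha', Or.inr hm⟩⟩

lemma IsTreeDecompOn.farSide_inter_nearSide (h : IsTreeDecompOn G T B) (t c : W) :
    farSide T B t c ∩ nearSide T B t c = B t := by
  refine subset_antisymm ?_ (Set.subset_inter (bag_subset_farSide t c) (bag_subset_nearSide t c))
  rintro v ⟨⟨a, ha, hm⟩, ⟨b, hb, rfl | hb'⟩⟩
  · exact hb
  · obtain ⟨r, hr⟩ := h.conn v a b ha hb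
    simp only [WalksMeet, not_forall] at hb'
    obtain ⟨q, hq⟩ := hb'
    have := hm (r.append q)
    rw [Walk.mem_support_append_iff] at this
    exact hr t (this.resolve_right hq)

/-- The bags of the part of the new decomposition covering `A`: a vertex of `A ∩ C` is added to
all bags between its old bags and `c`. -/
def splitBag (T : SimpleGraph W) (B : W → Set V) (A C : Set V) (c t : W) : Set V :=
  A ∩ (B t ∪ (C ∩ farSide T B t c))

lemma splitBag_subset_left (A C : Set V) (c t : W) : splitBag T B A C c t ⊆ A :=
  Set.inter_subset_left

lemma mem_splitBag_of_mem {A C : Set V} {c t : W} {v : V} (hv : v ∈ B t) (hA : v ∈ A) :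
    v ∈ splitBag T B A C c t := ⟨hA, Or.inl hv⟩

lemma mem_bag_of_mem_splitBag {A C : Set V} {c t : W} {v : V} (hv : v ∈ splitBag T B A C c t)
    (hC : v ∉ C) : v ∈ B t := hv.2.resolve_right fun h => hC h.1

lemma splitBag_conn_end (hT : T.IsTree) {A C : Set V} {c t : W} {v : V}
    (hv : v ∈ splitBag T B A C c t) (hC : v ∈ C) :
    ∃ p : T.Walk t c, ∀ x ∈ p.support, v ∈ splitBag T B A C c x := by
  have hfar : v ∈ farSide T B t c := hv.2.elim (fun h => bag_subset_farSide t c h) fun h => h.2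
  obtain ⟨a, ha, hm⟩ := hfar
  obtain ⟨q, hq⟩ := exists_isPath hT a c
  refine ⟨q.dropUntil t (hm q), fun x hx => ⟨hv.1, Or.inr ⟨hC, a, ha, ?_⟩⟩⟩
  exact walksMeet_of_isPath hT hq (q.support_dropUntil_subset_support _ hx)

/-- Two copies of the tree `T`, joined by an edge. -/
abbrev doubleTree (T : SimpleGraph W) (c₁ c₂ : W) : SimpleGraph (W ⊕ W) :=
  (T.sum T) ⊔ SimpleGraph.edge (.inl c₂) (.inr c₁)

lemma doubleTree_isTree [Finite W] (hT : T.IsTree) (c₁ c₂ : W) :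
    (doubleTree T c₁ c₂).IsTree := by
  rw [isTree_iff_connected_and_card]
  refine ⟨hT.connected.sum_sup_edge hT.connected, ?_⟩
  have hcard := (isTree_iff_connected_and_card.1 hT).2
  have h1 : Nat.card (T.sum T).edgeSet = Nat.card T.edgeSet + Nat.card T.edgeSet := by
    rw [Nat.card_congr edgeSetSumEquiv, Nat.card_sum]
  have h2 : (doubleTree T c₁ c₂).edgeSet = insert s(.inl c₂, .inr c₁) (T.sum T).edgeSet := by
    rw [edgeSet_sup, edgeSet_edge_of_ne (by simp), Set.union_singleton]
  have h3 : s(.inl c₂, .inr c₁) ∉ (T.sum T).edgeSet := by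
    rw [mem_edgeSet]
    exact not_adj_sum_inl_inr _ _
  rw [Nat.card_coe_set_eq] at h1 ⊢
  rw [h2, Set.ncard_insert_of_notMem h3, h1, Nat.card_sum, ← hcard]
  omega

/-- Splitting a tree-decomposition along a separation `(A, C)` of the graph. -/
lemma IsTreeDecompOn.split [Finite W] (h : IsTreeDecompOn G T B) {A C : Set V}
    (hAC : (A, C) ∈ graphSeps G) (c₁ c₂ : W) :
    IsTreeDecompOn G (doubleTree T c₁ c₂)
      (Sum.elim (splitBag T B A C c₂) (splitBag T B C A c₁)) := by
  rw [mem_graphSeps_iff] at hAC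
  set B' := Sum.elim (splitBag T B A C c₂) (splitBag T B C A c₁) with hB'
  let fl : T →g doubleTree T c₁ c₂ := (Hom.ofLE le_sup_left).comp Embedding.sumInl.toHom
  let fr : T →g doubleTree T c₁ c₂ := (Hom.ofLE le_sup_left).comp Embedding.sumInr.toHom
  have hl : ∀ {v : V} {a c : W} (p : T.Walk a c),
      (∀ x ∈ p.support, v ∈ splitBag T B A C c₂ x) →
      ∃ q : (doubleTree T c₁ c₂).Walk (.inl a) (.inl c), ∀ x ∈ q.support, v ∈ B' x := by
    intro v a c p hp
    refine ⟨p.map fl, fun x hx => ?_⟩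
    replace hx : x ∈ (p.map fl).support := hx
    rw [Walk.support_map, List.mem_map] at hx
    obtain ⟨y, hy, rfl⟩ := hx
    exact hp y hy
  have hr : ∀ {v : V} {a c : W} (p : T.Walk a c),
      (∀ x ∈ p.support, v ∈ splitBag T B C A c₁ x) →
      ∃ q : (doubleTree T c₁ c₂).Walk (.inr a) (.inr c), ∀ x ∈ q.support, v ∈ B' x := by
    intro v a c p hp
    refine ⟨p.map fr, fun x hx => ?_⟩
    replace hx : x ∈ (p.map fr).support := hx
    rw [Walk.support_map, List.mem_map] at hx
    obtain ⟨y, hy, rfl⟩ := hx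
    exact hp y hy
  refine ⟨doubleTree_isTree h.isTree c₁ c₂, fun v => ?_, fun u w huw => ?_, fun v a c ha hc => ?_⟩
  · obtain ⟨t, ht⟩ := h.cover v
    rcases hAC.1 v with hv | hv
    · exact ⟨.inl t, mem_splitBag_of_mem ht hv⟩
    · exact ⟨.inr t, mem_splitBag_of_mem ht hv⟩
  · obtain ⟨t, ht, ht'⟩ := h.edge u w huw
    rcases hAC.2 u w huw with hv | hv
    · exact ⟨.inl t, mem_splitBag_of_mem ht hv.1, mem_splitBag_of_mem ht' hv.2⟩
    · exact ⟨.inr t, mem_splitBag_of_mem ht hv.1, mem_splitBag_of_mem ht' hv.2⟩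
  · by_cases hA : v ∈ A
    · by_cases hC : v ∈ C
      · have hub : ∀ a, v ∈ B' a → ∃ q : (doubleTree T c₁ c₂).Walk a (.inl c₂),
            ∀ x ∈ q.support, v ∈ B' x := by
          rintro (a | a) ha
          · obtain ⟨p, hp⟩ := splitBag_conn_end h.isTree ha hC
            exact hl p hp
          · obtain ⟨p, hp⟩ := splitBag_conn_end h.isTree ha hA
            obtain ⟨q, hq⟩ := hr p hp
            have hadj : (doubleTree T c₁ c₂).Adj (.inr c₁) (.inl c₂) := by
              simp [doubleTree, SimpleGraph.edge]
            refine ⟨q.append (.cons hadj .nil), fun x hx => ?_⟩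
            rw [Walk.mem_support_append_iff] at hx
            rcases hx with hx | hx
            · exact hq x hx
            · simp only [Walk.support_cons, Walk.support_nil, List.mem_cons, List.not_mem_nil,
                or_false] at hx
              rcases hx with rfl | rfl
              · exact hq _ q.end_mem_support
              · obtain ⟨b, hb⟩ := h.cover v
                have : v ∈ splitBag T B A C c₂ b := mem_splitBag_of_mem hb hA
                obtain ⟨r, hr⟩ := splitBag_conn_end h.isTree this hC
                exact hr _ r.end_mem_support
        obtain ⟨p, hp⟩ := hub a ha
        obtain ⟨q, hq⟩ := hub c hc
        refine ⟨p.append q.reverse, fun x hx => ?_⟩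
        rw [Walk.mem_support_append_iff, Walk.support_reverse, List.mem_reverse] at hx
        exact hx.elim (hp x) (hq x)
      · rcases a with a | a
        · rcases c with c | c
          · obtain ⟨p, hp⟩ := h.conn v a c (mem_bag_of_mem_splitBag ha hC)
              (mem_bag_of_mem_splitBag hc hC)
            exact hl p fun x hx => mem_splitBag_of_mem (hp x hx) hA
          · exact absurd (splitBag_subset_left _ _ _ _ hc) hC
        · exact absurd (splitBag_subset_left _ _ _ _ ha) hC
    · rcases a with a | a
      · exact absurd (splitBag_subset_left _ _ _ _ ha) hA
      · rcases c with c | c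
        · exact absurd (splitBag_subset_left _ _ _ _ hc) hA
        · obtain ⟨p, hp⟩ := h.conn v a c (mem_bag_of_mem_splitBag ha hA)
            (mem_bag_of_mem_splitBag hc hA)
          exact hr p fun x hx => mem_splitBag_of_mem (hp x hx) ((hAC.1 v).resolve_left hA)

end TreeDecomposition

section Potential

open SimpleGraph

variable {V W : Type*} {G : SimpleGraph V} {T : SimpleGraph W} {B : W → Set V}

lemma finsum_mem_lt_finsum_mem [Finite V] {X Y : Set V} {d : V → ℕ} (hcard : X.ncard = Y.ncard)
    (hX : X.Nonempty) (h : ∀ x ∈ X, ∀ y ∈ Y, d x < d y) :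
    ∑ᶠ x ∈ X, d x < ∑ᶠ y ∈ Y, d y := by
  obtain ⟨m, hm, hmax⟩ := Set.exists_max_image X d X.toFinite hX
  rw [finsum_mem_eq_finite_toFinset_sum _ X.toFinite, finsum_mem_eq_finite_toFinset_sum _ Y.toFinite]
  have h1 := Finset.sum_le_card_nsmul X.toFinite.toFinset d (d m)
    (fun x hx => hmax x (by simpa using hx))
  have h2 := Finset.card_nsmul_le_sum Y.toFinite.toFinset d (d m + 1)
    (fun y hy => h m hm y (by simpa using hy))
  rw [← Set.ncard_eq_toFinset_card] at h1 h2
  have h3 : 0 < X.ncard := (Set.ncard_pos).2 hX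
  rw [← hcard] at h2
  simp only [smul_eq_mul] at h1 h2
  nlinarith

/-- The nodes outside the subtree of `s` which separate it from both `c₁` and `c₂`. Their number
is the distance of that subtree from the path between `c₁` and `c₂`. -/
def separatingNodes (T : SimpleGraph W) (B : W → Set V) (c₁ c₂ : W) (s : V) : Set W :=
  {t | s ∉ B t ∧ ∀ a, s ∈ B a → WalksMeet T t a c₁ ∧ WalksMeet T t a c₂}

lemma separatingNodes_comm (c₁ c₂ : W) :
    separatingNodes T B c₁ c₂ = separatingNodes T B c₂ c₁ := by
  funext s
  ext t
  simp only [separatingNodes, Set.mem_ofPred_eq, and_comm]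

/-- If `u` meets all walks from `t` to `c` and `t` meets all walks from `u` to `c`, then
`u = t`. -/
lemma WalksMeet.antisymm (hT : T.IsTree) {t u c : W} (h : WalksMeet T t u c)
    (h' : WalksMeet T u t c) : u = t := by
  obtain ⟨p, hp⟩ := exists_isPath hT u c
  by_contra hne
  have h1 := p.length_dropUntil_lt_length (h p) (fun e => hne e.symm)
  have h2 := (p.dropUntil t (h p)).length_dropUntil_le_length (h' _)
  have h3 := (hT.existsUnique_path u c).unique hp ((hp.dropUntil (h p)).dropUntil (h' _))
  rw [← h3] at h2
  omega

lemma WalksMeet.trans {u t a c : W} (h : WalksMeet T t a c) (h' : WalksMeet T u t c) :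
    WalksMeet T u a c := fun q =>
  q.support_dropUntil_subset_support (h q) (h' _)

lemma ncard_separatingNodes_lt [Finite W] (h : IsTreeDecompOn G T B) {c₁ c₂ t : W} {s x : V}
    (hs : t ∈ separatingNodes T B c₁ c₂ s) (hx : x ∈ B t) :
    (separatingNodes T B c₁ c₂ x).ncard < (separatingNodes T B c₁ c₂ s).ncard := by
  refine Set.ncard_lt_ncard ⟨fun u hu => ?_, fun hsub => (hsub hs).1 hx⟩
  obtain ⟨hu1, hu2⟩ := hu.2 t hx
  refine ⟨fun hsu => ?_, fun a ha =>
    ⟨(hs.2 a ha).1.trans hu1, (hs.2 a ha).2.trans hu2⟩⟩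
  exact hs.1 (((hs.2 u hsu).1.antisymm h.isTree hu1) ▸ hsu)

lemma ncard_eq_of_corner [Finite V] {A C U L b : Set V} (hAC : A ∪ C = Set.univ)
    (hUL : U ∪ L = Set.univ) (hb : U ∩ L = b) :
    (A ∩ (b ∪ (C ∩ U))).ncard = (b ∩ A).ncard + ((A ∩ C) \ L).ncard ∧
    b.ncard = (b ∩ A).ncard + (b \ A).ncard ∧
    (A ∩ C).ncard = ((A ∩ C) ∩ L).ncard + ((A ∩ C) \ L).ncard ∧
    (A ∪ U) ∩ (C ∩ L) = ((A ∩ C) ∩ L) ∪ (b \ A) ∧ Disjoint ((A ∩ C) ∩ L) (b \ A) := by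
  rw [Set.eq_univ_iff_forall] at hAC hUL
  refine ⟨?_, (Set.ncard_inter_add_ncard_sdiff_eq_ncard _ _).symm,
    (Set.ncard_inter_add_ncard_sdiff_eq_ncard _ _).symm, ?_, ?_⟩
  · rw [← Set.ncard_union_eq]
    · congr 1
      subst hb
      ext v
      have := hAC v
      have := hUL v
      simp only [Set.mem_inter_iff, Set.mem_union, Set.mem_sdiff] at *
      tauto
    · rw [Set.disjoint_left]
      subst hb
      rintro v ⟨hv, _⟩ hv'
      exact hv'.2 hv.2
  · subst hb
    ext v
    have := hAC v
    have := hUL v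
    simp only [Set.mem_inter_iff, Set.mem_union, Set.mem_sdiff] at *
    tauto
  · rw [Set.disjoint_left]
    rintro v ⟨⟨hv, _⟩, _⟩ hv'
    exact hv'.2 hv

/-- If `(A, C)` is a separation of `Z₁` from `Z₂` of minimum order and, subject to that, of minimum
total distance from the path between `c₁` and `c₂`, then splitting along it does not enlarge
any bag, and shrinks every bag not contained in `A`. -/
lemma IsTreeDecompOn.ncard_splitBag_le [Finite V] [Finite W] (h : IsTreeDecompOn G T B)
    {A C Z₁ Z₂ : Set V} {c₁ c₂ : W} {k : ℕ} (hAC : (A, C) ∈ graphSeps G) (hZ₁ : Z₁ ⊆ A)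
    (hZ₂ : Z₂ ⊆ C) (hZc : Z₂ ⊆ B c₂) (hlt : (A ∩ C).ncard < k)
    (hmin : ∀ A' C', (A', C') ∈ graphSeps G → Z₁ ⊆ A' → Z₂ ⊆ C' →
      (A ∩ C).ncard < (A' ∩ C').ncard ∨ ((A ∩ C).ncard = (A' ∩ C').ncard ∧
        ∑ᶠ s ∈ A ∩ C, (separatingNodes T B c₁ c₂ s).ncard ≤
          ∑ᶠ s ∈ A' ∩ C', (separatingNodes T B c₁ c₂ s).ncard))
    (p : T.Walk c₁ c₂) (hp : c₁ ≠ c₂ → ∀ t ∈ p.support, ∀ A' C', (A', C') ∈ graphSeps G →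
      B t ⊆ A' → Z₂ ⊆ C' → k ≤ (A' ∩ C').ncard) (t : W) :
    (splitBag T B A C c₂ t).ncard ≤ (B t).ncard ∧
      ((splitBag T B A C c₂ t).ncard = (B t).ncard → B t ⊆ A) := by
  have hUL := h.farSide_nearSide_mem t c₂
  set U := farSide T B t c₂ with hU
  set L := nearSide T B t c₂ with hL
  have hcorner := graphSeps_corner hAC hUL
  have hZL : Z₂ ⊆ C ∩ L := Set.subset_inter hZ₂ (hZc.trans (bag_end_subset_nearSide t c₂))
  obtain ⟨e1, e2, e3, e4, hdisj⟩ := ncard_eq_of_corner (A := A) (C := C) (U := U) (L := L)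
    hAC.1 hUL.1 (h.farSide_inter_nearSide t c₂)
  have e5 : ((A ∪ U) ∩ (C ∩ L)).ncard = ((A ∩ C) ∩ L).ncard + (B t \ A).ncard := by
    rw [e4, Set.ncard_union_eq hdisj]
  change (splitBag T B A C c₂ t).ncard = _ at e1
  have hm := hmin _ _ hcorner (hZ₁.trans Set.subset_union_left) hZL
  refine ⟨by omega, fun heq => ?_⟩
  by_contra hsub
  have hne : (B t \ A).Nonempty := Set.sdiff_nonempty.2 hsub
  have hcard : (B t \ A).ncard = ((A ∩ C) \ L).ncard := by omega
  have heq' : ((A ∪ U) ∩ (C ∩ L)).ncard = (A ∩ C).ncard := by omega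
  by_cases hcase : c₁ ≠ c₂ ∧ t ∈ p.support
  · have := hp hcase.1 t hcase.2 _ _ hcorner
      ((bag_subset_farSide t c₂).trans Set.subset_union_right) hZL
    omega
  · have hD : ∀ s ∈ (A ∩ C) \ L, t ∈ separatingNodes T B c₁ c₂ s := by
      rintro s ⟨_, hsL⟩
      have hs : ∀ a, s ∈ B a → a ≠ t ∧ WalksMeet T t a c₂ := by
        intro a ha
        have : ¬(a = t ∨ ¬WalksMeet T t a c₂) := fun h => hsL ⟨a, ha, h⟩
        tauto
      refine ⟨fun hst => (hs t hst).1 rfl, fun a ha => ⟨?_, (hs a ha).2⟩⟩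
      by_cases hc : c₁ = c₂
      · exact hc ▸ (hs a ha).2
      · intro q
        have := (hs a ha).2 (q.append p)
        rw [Walk.mem_support_append_iff] at this
        exact this.resolve_right fun h => hcase ⟨hc, h⟩
    have hlt' := finsum_mem_lt_finsum_mem (d := fun s => (separatingNodes T B c₁ c₂ s).ncard)
      hcard hne (fun x hx s hs => ncard_separatingNodes_lt h (hD s hs) hx.1)
    have hpot := (hm.resolve_left (by omega)).2
    rw [e4, finsum_mem_union hdisj (Set.toFinite _) (Set.toFinite _)] at hpot
    have hsplit : ∑ᶠ s ∈ A ∩ C, (separatingNodes T B c₁ c₂ s).ncard =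
        ∑ᶠ s ∈ (A ∩ C) ∩ L, (separatingNodes T B c₁ c₂ s).ncard +
          ∑ᶠ s ∈ (A ∩ C) \ L, (separatingNodes T B c₁ c₂ s).ncard :=
      (finsum_mem_inter_add_sdiff L (Set.toFinite _)).symm
    omega

lemma le_ncard_bag {k : ℕ} {a c : W} (p : T.Walk a c) (ha : k ≤ (B a).ncard) [Finite V]
    (hd : ∀ d ∈ p.darts, k ≤ (B d.toProd.1 ∩ B d.toProd.2).ncard) :
    ∀ t ∈ p.support, k ≤ (B t).ncard := by
  induction p with
  | nil => simpa using ha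
  | cons huv p ih =>
    simp only [Walk.darts_cons, List.mem_cons, forall_eq_or_imp] at hd
    simp only [Walk.support_cons, List.mem_cons, forall_eq_or_imp]
    exact ⟨ha, ih (hd.1.trans (Set.ncard_le_ncard Set.inter_subset_right)) hd.2⟩

lemma exists_hasDisjointPaths_of_mem_support [Finite V] {k : ℕ} {c₁ c₂ : W} {Z₂ : Set V}
    (p : T.Walk c₁ c₂) (hp : p.IsPath)
    (hd : ∀ d ∈ p.darts, k ≤ (B d.toProd.1 ∩ B d.toProd.2).ncard)
    (hshort : ∀ (a : W) (q : T.Walk a c₂), q.IsPath → q.length < p.length →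
      (∀ d ∈ q.darts, k ≤ (B d.toProd.1 ∩ B d.toProd.2).ncard) → ∀ Z ⊆ B a, Z.ncard = k →
      HasDisjointPaths G Z Z₂ k)
    (hne : c₁ ≠ c₂) {t : W} (ht : t ∈ p.support) :
    ∃ Z ⊆ B t, HasDisjointPaths G Z Z₂ k := by
  cases p with
  | nil => exact absurd rfl hne
  | @cons _ v _ huv q =>
    simp only [Walk.darts_cons, List.mem_cons, forall_eq_or_imp] at hd
    rw [Walk.cons_isPath_iff] at hp
    rw [Walk.support_cons, List.mem_cons] at ht
    rw [Walk.length_cons] at hshort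
    rcases ht with rfl | ht
    · obtain ⟨Z, hZ, hZk⟩ := Set.exists_subset_card_eq hd.1
      exact ⟨Z, hZ.trans Set.inter_subset_left, hshort v q hp.1 (by omega) hd.2 Z
        (hZ.trans Set.inter_subset_right) hZk⟩
    · obtain ⟨Z, hZ, hZk⟩ := Set.exists_subset_card_eq
        (le_ncard_bag q (hd.1.trans (Set.ncard_le_ncard Set.inter_subset_right)) hd.2 t ht)
      have := q.length_dropUntil_le_length ht
      exact ⟨Z, hZ, hshort t (q.dropUntil t ht) (hp.1.dropUntil ht) (by omega)
        (fun d hd' => hd.2 d (q.darts_dropUntil_subset_darts ht hd')) Z hZ hZk⟩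

end Potential

section Improvement

open SimpleGraph

variable {V W : Type*} {G : SimpleGraph V} {T : SimpleGraph W} {B : W → Set V}

/-- The path `p` and the sets `Z₁`, `Z₂` witness that `(T, B)` is not lean. -/
structure IsUnlinkedAlong (G : SimpleGraph V) (B : W → Set V) {a c : W} (p : T.Walk a c)
    (Z₁ Z₂ : Set V) (k : ℕ) : Prop where
  isPath : p.IsPath
  adhesion : ∀ d ∈ p.darts, k ≤ (B d.toProd.1 ∩ B d.toProd.2).ncard
  left : Z₁ ⊆ B a
  right : Z₂ ⊆ B c
  card_left : Z₁.ncard = k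
  card_right : Z₂.ncard = k
  not_paths : ¬HasDisjointPaths G Z₁ Z₂ k

lemma IsUnlinkedAlong.reverse {a c : W} {p : T.Walk a c} {Z₁ Z₂ : Set V} {k : ℕ}
    (h : IsUnlinkedAlong G B p Z₁ Z₂ k) : IsUnlinkedAlong G B p.reverse Z₂ Z₁ k where
  isPath := h.isPath.reverse
  adhesion d hd := by
    rw [Walk.mem_darts_reverse] at hd
    rw [Set.inter_comm]
    exact h.adhesion _ hd
  left := h.right
  right := h.left
  card_left := h.card_right
  card_right := h.card_left
  not_paths hp := h.not_paths hp.symm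

lemma IsUnlinkedAlong.le_ncard_inter_of_bag_subset [Finite V] {a c : W} {p : T.Walk a c}
    {Z₁ Z₂ : Set V} {k : ℕ} (h : IsUnlinkedAlong G B p Z₁ Z₂ k)
    (hmin : ∀ (a' c' : W) (q : T.Walk a' c') (Z Z' : Set V) (k' : ℕ),
      IsUnlinkedAlong G B q Z Z' k' → p.length ≤ q.length)
    (hne : a ≠ c) {t : W} (ht : t ∈ p.support) {A C : Set V} (hAC : (A, C) ∈ graphSeps G)
    (hA : B t ⊆ A) (hC : Z₂ ⊆ C) : k ≤ (A ∩ C).ncard := by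
  obtain ⟨Z, hZ, hpaths⟩ := exists_hasDisjointPaths_of_mem_support (G := G) p h.isPath h.adhesion
    (fun a' q hq hlen hd Z hZ hZk => by
      by_contra hnot
      have := hmin a' c q Z Z₂ k ⟨hq, hd, hZ, h.right, hZk, h.card_right, hnot⟩
      omega) hne ht
  exact hpaths.le_ncard_inter hAC (hZ.trans hA) hC

lemma exists_minimal_separation [Finite V] {Z₁ Z₂ : Set V} {k : ℕ}
    (h : ¬HasDisjointPaths G Z₁ Z₂ k) (f : Set V → ℕ) :
    ∃ A C, (A, C) ∈ graphSeps G ∧ Z₁ ⊆ A ∧ Z₂ ⊆ C ∧ (A ∩ C).ncard < k ∧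
      ∀ A' C', (A', C') ∈ graphSeps G → Z₁ ⊆ A' → Z₂ ⊆ C' →
        (A ∩ C).ncard < (A' ∩ C').ncard ∨
          ((A ∩ C).ncard = (A' ∩ C').ncard ∧ f (A ∩ C) ≤ f (A' ∩ C')) := by
  have h' : ∃ A C, (A, C) ∈ graphSeps G ∧ Z₁ ⊆ A ∧ Z₂ ⊆ C ∧ (A ∩ C).ncard < k := by
    by_contra! hcon
    exact h (hasDisjointPaths_of_forall_le G Z₁ Z₂ hcon)
  obtain ⟨A₀, C₀, h₀, h₁, h₂, hlt⟩ := h'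
  obtain ⟨⟨A, C⟩, ⟨hs, hA, hC⟩, hmin⟩ := Set.exists_min_image
    {s : OSep V | s ∈ graphSeps G ∧ Z₁ ⊆ s.1 ∧ Z₂ ⊆ s.2}
    (fun s => toLex ((s.1 ∩ s.2).ncard, f (s.1 ∩ s.2))) (Set.toFinite _) ⟨(A₀, C₀), h₀, h₁, h₂⟩
  have hmin' : ∀ A' C', (A', C') ∈ graphSeps G → Z₁ ⊆ A' → Z₂ ⊆ C' →
      (A ∩ C).ncard < (A' ∩ C').ncard ∨
        ((A ∩ C).ncard = (A' ∩ C').ncard ∧ f (A ∩ C) ≤ f (A' ∩ C')) :=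
    fun A' C' hs' hA' hC' => Prod.Lex.toLex_le_toLex.1 (hmin (A', C') ⟨hs', hA', hC'⟩)
  refine ⟨A, C, hs, hA, hC, ?_, hmin'⟩
  rcases hmin' A₀ C₀ h₀ h₁ h₂ with h | h <;> omega

/-- A tree-decomposition which is not lean can be split along a separation without enlarging any
bag, so that a bag of size at least `k` shrinks in both halves, while every other bag shrinks
below `k` in one half or shrinks in both. -/
lemma IsUnlinkedAlong.exists_split [Finite V] [Finite W] (hT : IsTreeDecompOn G T B)
    {c₁ c₂ : W} {p : T.Walk c₁ c₂} {Z₁ Z₂ : Set V} {k : ℕ} (h : IsUnlinkedAlong G B p Z₁ Z₂ k)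
    (hmin : ∀ (a c : W) (q : T.Walk a c) (Z Z' : Set V) (k' : ℕ),
      IsUnlinkedAlong G B q Z Z' k' → p.length ≤ q.length) :
    ∃ (T' : SimpleGraph (W ⊕ W)) (B₁ B₂ : W → Set V), IsTreeDecompOn G T' (Sum.elim B₁ B₂) ∧
      (∀ t, (B₁ t).ncard ≤ (B t).ncard ∧ (B₂ t).ncard ≤ (B t).ncard ∧
        ((B₁ t).ncard = (B t).ncard → (B₂ t).ncard < k) ∧
        ((B₂ t).ncard = (B t).ncard → (B₁ t).ncard < k)) ∧
      ∃ t, k ≤ (B t).ncard ∧ (B₁ t).ncard < (B t).ncard ∧ (B₂ t).ncard < (B t).ncard := by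
  obtain ⟨A, C, hAC, hA, hC, hlt, hsep⟩ := exists_minimal_separation h.not_paths
    (fun S => ∑ᶠ s ∈ S, (separatingNodes T B c₁ c₂ s).ncard)
  have h₁ := hT.ncard_splitBag_le hAC hA hC h.right hlt hsep p
    fun hne t ht A' C' hs hA' hC' => h.le_ncard_inter_of_bag_subset hmin hne ht hs hA' hC'
  have h₂ := hT.ncard_splitBag_le (graphSeps_swap hAC) hC hA h.left
    (by rwa [Set.inter_comm])
    (fun A' C' hs hA' hC' => by
      have := hsep C' A' (graphSeps_swap hs) hC' hA'
      rwa [Set.inter_comm C A, Set.inter_comm A' C', separatingNodes_comm c₂ c₁])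
    p.reverse
    fun hne t ht A' C' hs hA' hC' => h.reverse.le_ncard_inter_of_bag_subset
      (fun a c q Z Z' k' hq => by simpa using hmin a c q Z Z' k' hq) hne ht hs hA' hC'
  refine ⟨_, _, _, hT.split hAC c₁ c₂, fun t => ⟨(h₁ t).1, (h₂ t).1, fun he => ?_, fun he => ?_⟩,
    c₁, h.card_left ▸ Set.ncard_le_ncard h.left, (h₁ c₁).1.lt_of_ne fun he => ?_,
    (h₂ c₁).1.lt_of_ne fun he => ?_⟩
  · refine (Set.ncard_le_ncard ?_).trans_lt hlt
    exact fun v hv => ⟨hv.2.elim (fun hb => (h₁ t).2 he hb) fun hb => hb.1, hv.1⟩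
  · refine (Set.ncard_le_ncard ?_).trans_lt hlt
    exact fun v hv => ⟨hv.1, hv.2.elim (fun hb => (h₂ t).2 he hb) fun hb => hb.1⟩
  · have hsub := (h₁ c₁).2 he
    refine hlt.not_ge ?_
    by_cases hc : c₁ = c₂
    · subst hc
      exact h.card_right ▸ Set.ncard_le_ncard (Set.subset_inter (h.right.trans hsub) hC)
    · exact h.le_ncard_inter_of_bag_subset hmin hc p.start_mem_support hAC hsub hC
  · have hsub := (h₂ c₁).2 he
    exact hlt.not_ge (h.card_left ▸ Set.ncard_le_ncard (Set.subset_inter hA (h.left.trans hsub)))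

/-- The multiset of bag sizes. -/
def bagSizes [Fintype W] (B : W → Set V) : Multiset ℕ := ∑ t, {(B t).ncard}

lemma isDershowitzMannaLT_bagSizes [Fintype W] {k : ℕ} {B₁ B₂ : W → Set V}
    (h : ∀ t, (B₁ t).ncard ≤ (B t).ncard ∧ (B₂ t).ncard ≤ (B t).ncard ∧
      ((B₁ t).ncard = (B t).ncard → (B₂ t).ncard < k) ∧
      ((B₂ t).ncard = (B t).ncard → (B₁ t).ncard < k))
    (hs : ∃ t, k ≤ (B t).ncard ∧ (B₁ t).ncard < (B t).ncard ∧ (B₂ t).ncard < (B t).ncard) :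
    (bagSizes (Sum.elim B₁ B₂)).IsDershowitzMannaLT (bagSizes B) := by
  obtain ⟨t₀, hk, hx, hy⟩ := hs
  set m : W → ℕ := fun t => max (B₁ t).ncard (B₂ t).ncard with hm
  set l : W → ℕ := fun t => min (B₁ t).ncard (B₂ t).ncard with hl
  set P : W → Prop := fun t => m t = (B t).ncard
  have hP : ∀ t, ¬P t → m t < (B t).ncard := fun t ht =>
    lt_of_le_of_ne (max_le (h t).1 (h t).2.1) ht
  have ht₀ : ¬P t₀ := (max_lt hx hy).ne
  refine ⟨∑ t with P t, {(B t).ncard}, ∑ t with ¬P t, {m t} + ∑ t, {l t},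
    ∑ t with ¬P t, {(B t).ncard}, ?_, ?_, ?_, ?_⟩
  · intro h0
    have : (B t₀).ncard ∈ ∑ t with ¬P t, ({(B t).ncard} : Multiset ℕ) :=
      Multiset.mem_sum.2 ⟨t₀, by simpa using ht₀, by simp⟩
    simp [h0] at this
  · have hsum : bagSizes (Sum.elim B₁ B₂) = ∑ t, {m t} + ∑ t, {l t} := by
      rw [bagSizes, Fintype.sum_sum_type, ← Finset.sum_add_distrib, ← Finset.sum_add_distrib]
      refine Finset.sum_congr rfl fun t _ => ?_
      simp only [Sum.elim_inl, Sum.elim_inr, hm, hl]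
      rcases le_total (B₁ t).ncard (B₂ t).ncard with hle | hle
      · rw [max_eq_right hle, min_eq_left hle, add_comm]
      · rw [max_eq_left hle, min_eq_right hle]
    rw [hsum, ← Finset.sum_filter_add_sum_filter_not Finset.univ P (fun t => ({m t} : Multiset ℕ)),
      add_assoc]
    congr 1
    refine Finset.sum_congr rfl fun t ht => ?_
    rw [(Finset.mem_filter.1 ht).2]
  · exact (Finset.sum_filter_add_sum_filter_not Finset.univ P _).symm
  · intro y hy'
    have key : ∀ t, ¬P t → (B t).ncard ∈ ∑ t with ¬P t, ({(B t).ncard} : Multiset ℕ) :=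
      fun t ht => Multiset.mem_sum.2 ⟨t, by simpa using ht, by simp⟩
    rcases Multiset.mem_add.1 hy' with hy' | hy'
    · obtain ⟨t, ht, hyt⟩ := Multiset.mem_sum.1 hy'
      rw [Multiset.mem_singleton] at hyt
      have ht := (Finset.mem_filter.1 ht).2
      exact ⟨_, key t ht, hyt ▸ hP t ht⟩
    · obtain ⟨t, -, hyt⟩ := Multiset.mem_sum.1 hy'
      rw [Multiset.mem_singleton] at hyt
      by_cases ht : P t
      · refine ⟨_, key t₀ ht₀, ?_⟩
        have h' := h t
        simp only [P, m] at ht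
        simp only [l] at hyt
        omega
      · exact ⟨_, key t ht, hyt ▸ (min_le_max.trans_lt (hP t ht))⟩

lemma exists_isTreeDecomp (G : SimpleGraph V) :
    ∃ (n : ℕ) (T : SimpleGraph (Fin n)) (B : Fin n → Set V), IsTreeDecomp G T B :=
  ⟨1, ⊥, fun _ => Set.univ, IsTree.of_subsingleton, fun _ => ⟨0, trivial⟩,
    fun _ _ _ => ⟨0, trivial, trivial⟩, fun _ _ _ _ _ _ _ _ => trivial⟩

lemma IsTreeDecomp.exists_bagSizes_lt [Finite V] {n : ℕ} {T : SimpleGraph (Fin n)}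
    {B : Fin n → Set V} (hT : IsTreeDecomp G T B) (hlean : ¬IsLeanDecomp G T B) :
    ∃ (n' : ℕ) (T' : SimpleGraph (Fin n')) (B' : Fin n' → Set V), IsTreeDecomp G T' B' ∧
      (∀ t', ∃ t, (B' t').ncard ≤ (B t).ncard) ∧
      (bagSizes B').IsDershowitzMannaLT (bagSizes B) := by
  have hex : ∃ (ℓ : ℕ) (a c : Fin n) (p : T.Walk a c) (Z₁ Z₂ : Set V) (k : ℕ),
      IsUnlinkedAlong G B p Z₁ Z₂ k ∧ p.length = ℓ := by
    simp only [IsLeanDecomp] at hlean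
    push Not at hlean
    obtain ⟨k, a, c, Z₁, Z₂, h1, h2, h3, h4, h5, p, hp, hd⟩ := hlean
    exact ⟨_, a, c, p, Z₁, Z₂, k, ⟨hp, hd, h1, h2, h3, h4, h5⟩, rfl⟩
  obtain ⟨c₁, c₂, p, Z₁, Z₂, k, h, hlen⟩ := Nat.find_spec hex
  obtain ⟨T', B₁, B₂, hT', hle, hs⟩ := h.exists_split (isTreeDecomp_iff.1 hT)
    fun a c q Z Z' k' hq => hlen ▸ Nat.find_min' hex ⟨a, c, q, Z, Z', k', hq, rfl⟩
  refine ⟨n + n, _, _, isTreeDecomp_iff.2 (hT'.transport finSumFinEquiv.symm), fun t' => ?_, ?_⟩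
  · rcases ht : finSumFinEquiv.symm t' with t | t
    · exact ⟨t, by simpa [ht] using (hle t).1⟩
    · exact ⟨t, by simpa [ht] using (hle t).2.1⟩
  · convert isDershowitzMannaLT_bagSizes hle hs using 1
    exact Fintype.sum_equiv finSumFinEquiv.symm _ _ fun _ => rfl

end Improvement

/-- Every finite graph `G` admits a lean tree-decomposition of width
`tw(G)`. -/
theorem graph_admits_lean_treeDecomposition {V : Type*} [Fintype V] (G : SimpleGraph V) :
    ∃ (n : ℕ) (T : SimpleGraph (Fin n)) (B : Fin n → Set V),
      IsTreeDecomp G T B ∧ tdWidth B = treeWidth G ∧ IsLeanDecomp G T B := by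
  obtain ⟨n₀, T₀, B₀, h₀, hw₀⟩ : ∃ (n : ℕ) (T : SimpleGraph (Fin n)) (B : Fin n → Set V),
      IsTreeDecomp G T B ∧ tdWidth B = treeWidth G := by
    obtain ⟨n, T, B, h⟩ := exists_isTreeDecomp G
    exact Nat.sInf_mem (s := {w | ∃ (n : ℕ) (T : SimpleGraph (Fin n)) (B : Fin n → Set V),
      IsTreeDecomp G T B ∧ tdWidth B = w}) ⟨_, n, T, B, h, rfl⟩
  have key : ∀ (s : Multiset ℕ) (n : ℕ) (T : SimpleGraph (Fin n)) (B : Fin n → Set V),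
      bagSizes B = s → IsTreeDecomp G T B → tdWidth B = treeWidth G →
      ∃ (n : ℕ) (T : SimpleGraph (Fin n)) (B : Fin n → Set V),
        IsTreeDecomp G T B ∧ tdWidth B = treeWidth G ∧ IsLeanDecomp G T B := by
    intro s
    have hwf := Multiset.wellFounded_isDershowitzMannaLT (α := ℕ)
    induction s using hwf.induction with
    | _ s ih =>
      rintro n T B rfl h hw
      by_cases hlean : IsLeanDecomp G T B
      · exact ⟨n, T, B, h, hw, hlean⟩
      obtain ⟨n', T', B', h', hle, hlt⟩ := h.exists_bagSizes_lt hlean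
      refine ih _ hlt n' T' B' rfl h' (le_antisymm ?_ (Nat.sInf_le ⟨n', T', B', h', rfl⟩))
      rw [← hw]
      refine Nat.sub_le_sub_right (Finset.sup_le fun t' _ => ?_) 1
      obtain ⟨t, ht⟩ := hle t'
      exact ht.trans (Finset.le_sup (f := fun t => (B t).ncard) (Finset.mem_univ t))
  exact key _ n₀ T₀ B₀ rfl h₀ hw₀
end
end

section
/- Let V be a finite set, let r : 2^V → ℕ be submodular, let Z_0, Z_1, …, Z_n, X ⊆ V, and write Z*_i := ⋂_{j=0}^{i} Z_j. If Z*_i ∪ Z_{i+1} = V for each 0 ≤ i ≤ n−1, then Σ_{i=0}^{n} r(Z_i ∩ X) ≥ r(Z*_n ∩ X) + n·r(X). -/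
open scoped Classical

noncomputable section

/-- Claim `c:starint`. If `Z*_i ∪ Z_{i+1} = V` for each `i < n`, then
`Σ_{i=0}^{n} r(Z_i ∩ X) ≥ r(Z*_n ∩ X) + n·r(X)`. -/
theorem submodular_chain_inequality {V : Type*} [Fintype V] (r : Set V → ℕ)
    (hsub : Submodular r) (n : ℕ) (Z : ℕ → Set V) (X : Set V)
    (h : ∀ i < n, (⋂ j ∈ Finset.range (i + 1), Z j) ∪ Z (i + 1) = Set.univ) :
    r ((⋂ j ∈ Finset.range (n + 1), Z j) ∩ X) + n * r X ≤
      ∑ i ∈ Finset.range (n + 1), r (Z i ∩ X) := by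
  induction n with
  | zero => simp
  | succ n ih =>
    have hn := ih fun i hi => h i (hi.trans n.lt_succ_self)
    have hcover := h n n.lt_succ_self
    have hinter : (⋂ j ∈ Finset.range (n + 1 + 1), Z j) =
        (⋂ j ∈ Finset.range (n + 1), Z j) ∩ Z (n + 1) := by
      rw [Finset.range_add_one (n := n + 1), Finset.set_biInter_insert, Set.inter_comm]
    have hr := hsub ((⋂ j ∈ Finset.range (n + 1), Z j) ∩ X) (Z (n + 1) ∩ X)
    rw [← Set.inter_inter_distrib_right, ← Set.union_inter_distrib_right, hcover,
      Set.univ_inter] at hr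
    rw [hinter, Finset.sum_range_succ, Nat.succ_mul]
    omega
end
end

section
/- Let S⃗ be a universe of set separations over a finite set V with the order function |X,Y|_r = r(X) + r(Y) − r(V) for a non-negative non-decreasing submodular function r : 2^V → ℕ. If σ is a star of separations in S⃗ and (A,B) ∈ σ, then ⟨σ⟩_r ≥ |A,B|_r. -/
open scoped Classical

noncomputable section

theorem IsStar.mono {V : Type*} {σ τ : Multiset (OSep V)} (hσ : IsStar σ) (h : τ ≤ σ) :
    IsStar τ :=
  fun a b hab => hσ a b (hab.trans h)

theorem IsStar.le_flip_of_cons {V : Type*} {a b : OSep V} {τ : Multiset (OSep V)}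
    (hστ : IsStar (a ::ₘ τ)) (hb : b ∈ τ) : OSep.le a b.flip :=
  hστ a b (Multiset.cons_le_cons a (Multiset.singleton_le.2 hb))

theorem intStar_cons {V : Type*} (a : OSep V) (τ : Multiset (OSep V)) :
    intStar (a ::ₘ τ) = a.2 ∩ intStar τ := by
  ext v
  simp [intStar]

theorem IsStar.fst_subset_intStar {V : Type*} {a : OSep V} {τ : Multiset (OSep V)}
    (hστ : IsStar (a ::ₘ τ)) : a.1 ⊆ intStar τ :=
  fun _ hv _ hb => (hστ.le_flip_of_cons hb).1 hv

/-- The size of a star is at least the rank of its interior. -/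
theorem IsStar.intStar_add_card_mul_le {V : Type*} {r : Set V → ℕ} (hsub : Submodular r)
    {σ : Multiset (OSep V)} (hσ : IsStar σ) (hcov : ∀ s ∈ σ, s.1 ∪ s.2 = Set.univ) :
    r (intStar σ) + Multiset.card σ * r Set.univ ≤
      (σ.map fun s => r s.2).sum + r Set.univ := by
  induction σ using Multiset.induction_on with
  | empty => simp [intStar]
  | cons a τ ih =>
    have hτ := ih (hσ.mono (Multiset.le_cons_self τ a))
      fun s hs => hcov s (Multiset.mem_cons_of_mem hs)
    have hunion : a.2 ∪ intStar τ = Set.univ :=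
      Set.univ_subset_iff.1 <| by
        rw [← hcov a (Multiset.mem_cons_self a τ), Set.union_comm]
        exact Set.union_subset_union_right _ hσ.fst_subset_intStar
    have hr := hsub a.2 (intStar τ)
    rw [hunion] at hr
    rw [intStar_cons, Multiset.card_cons, Multiset.map_cons, Multiset.sum_cons, add_mul]
    omega

/-- Lemma `l:sepstar`, first part. If `σ` is a star and `(A,B) ∈ σ`,
then `⟨σ⟩_r ≥ |A,B|_r`. -/
theorem starSize_ge_ordOf {V : Type*} [Fintype V] (S : Set (OSep V)) (r : Set V → ℕ)
    (hU : IsUniverse S) (hsub : Submodular r) (hmono : Monotone r)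
    (σ : Multiset (OSep V)) (hσS : ∀ s ∈ σ, s ∈ S) (hstar : IsStar σ)
    (a : OSep V) (ha : a ∈ σ) :
    ordOf r a ≤ starSize r σ := by
  obtain ⟨τ, rfl⟩ := Multiset.exists_cons_of_mem ha
  have hint := hmono hstar.fst_subset_intStar
  have hsize := (hstar.mono (Multiset.le_cons_self τ a)).intStar_add_card_mul_le hsub
    fun s hs => hU.covers s (hσS s (Multiset.mem_cons_of_mem hs))
  simp only [ordOf, starSize, Multiset.map_cons, Multiset.sum_cons, Multiset.card_cons,
    Nat.add_sub_cancel]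
  omega
end
end

section
/- Let S⃗ be a universe of set separations, let (T,α) be a tame S-tree, let e⃗ be an oriented edge of T with α(e⃗) = (A,B), and let (X,Y) ∈ S⃗ with (A,B) ≤ (X,Y). Then the shift of (T,α) onto (X,Y) with respect to e⃗ is a tame S-tree. -/
open scoped Classical

noncomputable section

theorem IsStar.map_val {ι V : Type*} {s : Finset ι} {f : ι → OSep V}
    (h : ∀ i ∈ s, ∀ j ∈ s, i ≠ j → OSep.le (f i) (f j).flip) : IsStar (s.val.map f) := by
  intro a b hab
  obtain ⟨i, hi, rfl⟩ := Multiset.mem_map.1 (Multiset.mem_of_le hab (Multiset.mem_cons_self a _))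
  rw [← Multiset.cons_erase hi, Multiset.map_cons, Multiset.cons_le_cons_iff,
    Multiset.singleton_le] at hab
  obtain ⟨j, hj, rfl⟩ := Multiset.mem_map.1 hab
  rw [s.nodup.mem_erase_iff] at hj
  exact h i hi j hj.2 hj.1.symm

theorem IsStar.le_flip_of_ne {ι V : Type*} {s : Finset ι} {f : ι → OSep V}
    (h : IsStar (s.val.map f)) {i j : ι} (hi : i ∈ s) (hj : j ∈ s) (hij : i ≠ j) :
    OSep.le (f i) (f j).flip := by
  apply h
  rw [← Multiset.cons_erase hi, Multiset.map_cons, Multiset.cons_le_cons_iff,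
    Multiset.singleton_le]
  exact Multiset.mem_map_of_mem f (s.nodup.mem_erase_iff.2 ⟨hij.symm, hj⟩)

theorem isStar_starAt_iff {W V : Type*} [Fintype W] {T : SimpleGraph W} {α : T.Dart → OSep V}
    {t : W} : IsStar (starAt T α t) ↔ ∀ d d' : T.Dart, d.snd = t → d'.snd = t → d ≠ d' →
      OSep.le (α d) (α d').flip := by
  constructor
  · intro h d d' hd hd'
    exact h.le_flip_of_ne (by simpa using hd) (by simpa using hd')
  · intro h
    refine IsStar.map_val fun d hd d' hd' => h d d' ?_ ?_
    · simpa using hd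
    · simpa using hd'

theorem OSep.flip_flip {V : Type*} (s : OSep V) : s.flip.flip = s := rfl

theorem OSep.le.flip {V : Type*} {s t : OSep V} (h : OSep.le s t) : OSep.le t.flip s.flip :=
  ⟨h.2, h.1⟩

theorem OSep.le.union_right {V : Type*} {s t : OSep V} (h : OSep.le s t) (x : OSep V) :
    OSep.le (s.union x) (t.union x) :=
  ⟨Set.union_subset_union_left _ h.1, Set.inter_subset_inter_left _ h.2⟩

theorem OSep.le.flip_union_flip {V : Type*} {s t : OSep V} (h : OSep.le s.flip t) (x : OSep V) :
    OSep.le (s.union x).flip (t.union x) :=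
  ⟨Set.inter_subset_left.trans (h.1.trans Set.subset_union_left),
    Set.inter_subset_left.trans (h.2.trans Set.subset_union_left)⟩

theorem liftDart_injective {W : Type*} {T : SimpleGraph W} {U : Set W} :
    Function.Injective (liftDart : (T.induce U).Dart → T.Dart) := by
  intro d d' h
  have h := congrArg SimpleGraph.Dart.toProd h
  simp only [liftDart, Prod.mk.injEq] at h
  exact SimpleGraph.Dart.ext _ _ (Prod.ext (Subtype.ext h.1) (Subtype.ext h.2))

theorem SimpleGraph.Walk.IsPath.fst_eq_penultimate {W : Type*} {T : SimpleGraph W} {u : W}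
    {d : T.Dart} {p : T.Walk u d.snd} (hp : p.IsPath) (hd : d ∈ p.darts) :
    d.fst = p.penultimate :=
  hp.eq_penultimate_of_mem_edges (by
    rw [Sym2.eq_swap]
    exact List.mem_map_of_mem hd)

theorem mem_shiftSet_of_mem_support {W : Type*} {T : SimpleGraph W} (hT : T.IsTree) {e : T.Dart}
    {v w : W} (hv : v ∈ shiftSet T e) {p : T.Walk e.fst v} (hp : p.IsPath) (hw : w ∈ p.support) :
    w ∈ shiftSet T e := by
  by_cases hwe : w = e.fst
  · exact Or.inl hwe
  rcases hv with rfl | hv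
  · rw [SimpleGraph.Walk.isPath_iff_nil, ← SimpleGraph.Walk.eq_nil_iff_nil] at hp
    subst hp
    exact Or.inl (by simpa using hw)
  obtain ⟨p₀, p₁, hp₀, -, rfl⟩ := hp.mem_support_iff_exists_append.mp hw
  refine Or.inr fun q hq => ?_
  rw [(hT.existsUnique_path _ _).unique hq hp₀]
  have h := hv _ hp
  rw [SimpleGraph.Walk.darts_append, List.mem_append] at h
  refine h.resolve_right fun h => ?_
  exact hp.ne_of_mem_support_of_append (Ne.symm hwe) p₀.start_mem_support
    (p₁.dart_fst_mem_support_of_mem_darts h) rfl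

theorem isTree_induce_shiftSet {W : Type*} {T : SimpleGraph W} (hT : T.IsTree) (e : T.Dart) :
    (T.induce (shiftSet T e)).IsTree := by
  refine ⟨?_, hT.isAcyclic.induce _⟩
  rw [SimpleGraph.connected_iff_exists_forall_reachable]
  refine ⟨⟨e.fst, Or.inl rfl⟩, fun v => ?_⟩
  obtain ⟨p, hp⟩ := hT.connected.exists_isPath e.fst v.1
  exact ⟨p.induce _ fun w hw => mem_shiftSet_of_mem_support hT v.2 hp hw⟩

theorem dartLE_of_notMem_support {W : Type*} {T : SimpleGraph W} (hT : T.IsTree) {e d : T.Dart}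
    (hd : d.snd ∈ shiftSet T e) {p : T.Walk e.fst d.fst} (hp : p.IsPath)
    (h : d.snd ∉ p.support) : dartLE T e d := by
  intro q hq
  have hd := hd.resolve_left (ne_of_mem_of_not_mem p.start_mem_support h).symm
  refine ⟨hd q hq, ?_⟩
  rw [(hT.existsUnique_path _ _).unique hq (hp.concat h d.adj), SimpleGraph.Walk.darts_concat]
  simp

/-- Of a dart of the subtree `T(e⃗)` and its reverse, exactly one lies above `e⃗`. -/
theorem dartLE_symm_iff {W : Type*} {T : SimpleGraph W} (hT : T.IsTree) {e d : T.Dart}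
    (h₁ : d.fst ∈ shiftSet T e) (h₂ : d.snd ∈ shiftSet T e) :
    dartLE T e d.symm ↔ ¬ dartLE T e d := by
  obtain ⟨p, hp⟩ := hT.connected.exists_isPath e.fst d.fst
  obtain ⟨q, hq⟩ := hT.connected.exists_isPath e.fst d.snd
  constructor
  · intro h h'
    exact hT.isAcyclic.ne_mem_support_of_support_of_adj_of_isPath hp hq d.adj
      (p.dart_fst_mem_support_of_mem_darts (h p hp).2)
      (q.dart_fst_mem_support_of_mem_darts (h' q hq).2)
  · intro h
    have hmem : d.snd ∈ p.support := by
      by_contra hn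
      exact h (dartLE_of_notMem_support hT h₂ hp hn)
    exact dartLE_of_notMem_support (d := d.symm) hT h₁ hq
      (hT.isAcyclic.ne_mem_support_of_support_of_adj_of_isPath hp hq d.adj hmem)

theorem dartLE.eq_of_snd_eq {W : Type*} {T : SimpleGraph W} (hT : T.IsTree) {e d d' : T.Dart}
    (h : dartLE T e d) (h' : dartLE T e d') (hs : d.snd = d'.snd) : d = d' := by
  obtain ⟨⟨u, v⟩, hd⟩ := d
  obtain ⟨⟨u', v'⟩, hd'⟩ := d'
  obtain rfl : v = v' := hs
  obtain ⟨p, hp⟩ := hT.connected.exists_isPath e.fst v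
  have h₁ : u = p.penultimate := hp.fst_eq_penultimate (h p hp).2
  have h₂ : u' = p.penultimate := hp.fst_eq_penultimate (h' p hp).2
  obtain rfl : u = u' := h₁.trans h₂.symm
  rfl

/-- Lemma `l:tree`. The shift of a tame `S`-tree `(T,α)` onto `(X,Y)`
with respect to `e⃗`, where `α(e⃗) ≤ (X,Y)`, is a tame `S`-tree. -/
theorem shift_isTame {V : Type*} [Fintype V] (S : Set (OSep V)) (hU : IsUniverse S)
    (n : ℕ) (T : SimpleGraph (Fin n)) (hT : T.IsTree) (α : T.Dart → OSep V)
    (hinv : ∀ d, α d.symm = (α d).flip) (hrange : ∀ d, α d ∈ S)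
    (htame : ∀ t, IsStar (starAt T α t))
    (e : T.Dart) (X : OSep V) (hX : X ∈ S) (hle : OSep.le (α e) X) :
    (T.induce (shiftSet T e)).IsTree ∧
    (∀ d, shiftAlpha T α e X d.symm = (shiftAlpha T α e X d).flip) ∧
    (∀ d, shiftAlpha T α e X d ∈ S) ∧
    (∀ t, IsStar (starAt (T.induce (shiftSet T e)) (shiftAlpha T α e X) t)) := by
  have hsymm : ∀ d : (T.induce (shiftSet T e)).Dart,
      dartLE T e (liftDart d).symm ↔ ¬ dartLE T e (liftDart d) := fun d =>
    dartLE_symm_iff hT d.fst.2 d.snd.2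
  refine ⟨isTree_induce_shiftSet hT e, fun d => ?_, fun d => ?_, fun t => isStar_starAt_iff.2 ?_⟩
  · have hlift : liftDart d.symm = (liftDart d).symm := rfl
    by_cases h : dartLE T e (liftDart d)
    · have h' := mt (hsymm d).1 (not_not.2 h)
      simp [shiftAlpha, hlift, h, h']
    · have h' := (hsymm d).2 h
      simp [shiftAlpha, hlift, h, h', OSep.flip_flip]
  · unfold shiftAlpha
    split_ifs
    · exact hU.union_mem _ (hrange _) _ hX
    · exact hU.flip_mem _ (hU.union_mem _ (hrange _) _ hX)
  · intro d d' hd hd' hne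
    have hne' : liftDart d ≠ liftDart d' := liftDart_injective.ne hne
    have hstar : OSep.le (α (liftDart d)) (α (liftDart d')).flip :=
      isStar_starAt_iff.1 (htame t) _ _ (congrArg Subtype.val hd) (congrArg Subtype.val hd') hne'
    unfold shiftAlpha
    split_ifs with h h' h'
    · exact absurd (h.eq_of_snd_eq hT h' (congrArg Subtype.val (hd.trans hd'.symm))) hne'
    · rw [hinv, OSep.flip_flip]
      exact hstar.union_right X
    · rw [hinv]
      exact (hstar.flip.union_right X).flip
    · rw [hinv, hinv, OSep.flip_flip]
      exact OSep.le.flip_union_flip (s := (α (liftDart d)).flip) hstar X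
end
end

section
/- Let S⃗ be a universe of set separations with an order function |.|, let k ∈ ℕ, and let F be a family of stars in S⃗ that is fixed under shifting. Let (T,α) be a tame S_k-tree and let e⃗ = (t,t') be an oriented edge of T such that α(F⃗_s) ∈ F for every vertex s of T(e⃗) other than t. If (X,Y) is linked to α(e⃗), then the shift of (T,α) onto (X,Y) with respect to e⃗ is a tame S_k-tree over F ∪ {{(Y,X)}}; furthermore, if {(Y,X)} ∉ F then t is the unique vertex of T(e⃗) with α'(F⃗_t) = {(Y,X)}. -/
open scoped Classical

noncomputable section

theorem SimpleGraph.IsTree.isPath_unique {W : Type*} {T : SimpleGraph W} (hT : T.IsTree)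
    {u v : W} {p q : T.Walk u v} (hp : p.IsPath) (hq : q.IsPath) : p = q :=
  (hT.existsUnique_path u v).unique hp hq

/-- A dart at the start of a path that is traversed by the path is its first dart. -/
theorem SimpleGraph.Walk.IsPath.exists_eq_cons_of_mem_darts {W : Type*} {T : SimpleGraph W}
    {e : T.Dart} {v : W} {p : T.Walk e.toProd.1 v} (hp : p.IsPath) (he : e ∈ p.darts) :
    ∃ q : T.Walk e.toProd.2 v, p = SimpleGraph.Walk.cons e.adj q := by
  obtain ⟨⟨x, y⟩, hxy⟩ := e
  cases p with
  | nil => simp at he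
  | cons h q =>
    rw [SimpleGraph.Walk.cons_isPath_iff] at hp
    rw [SimpleGraph.Walk.darts_cons, List.mem_cons] at he
    rcases he with he | he
    · cases he
      exact ⟨q, rfl⟩
    · exact absurd (q.dart_fst_mem_support_of_mem_darts he) hp.2

theorem mem_shiftSet_iff {W : Type*} {T : SimpleGraph W} (hT : T.IsTree) {e : T.Dart} {v : W}
    {p : T.Walk e.toProd.1 v} (hp : p.IsPath) :
    v ∈ shiftSet T e ↔ v = e.toProd.1 ∨ e ∈ p.darts := by
  refine or_congr_right ⟨fun h => h p hp, fun h q hq => ?_⟩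
  rwa [hT.isPath_unique hq hp]

theorem dartLE_iff {W : Type*} {T : SimpleGraph W} (hT : T.IsTree) {d d' : T.Dart}
    {p : T.Walk d.toProd.1 d'.toProd.2} (hp : p.IsPath) :
    dartLE T d d' ↔ d ∈ p.darts ∧ d' ∈ p.darts := by
  refine ⟨fun h => h p hp, fun h q hq => ?_⟩
  rwa [hT.isPath_unique hq hp]

theorem fst_mem_shiftSet {W : Type*} (T : SimpleGraph W) (e : T.Dart) :
    e.toProd.1 ∈ shiftSet T e := Or.inl rfl

theorem snd_mem_shiftSet {W : Type*} {T : SimpleGraph W} (hT : T.IsTree) (e : T.Dart) :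
    e.toProd.2 ∈ shiftSet T e := by
  have hp : (SimpleGraph.Walk.cons e.adj SimpleGraph.Walk.nil).IsPath := by simp [e.adj.ne]
  exact (mem_shiftSet_iff hT hp).2 (Or.inr (by simp))

theorem support_subset_shiftSet {W : Type*} {T : SimpleGraph W} (hT : T.IsTree) {e : T.Dart}
    {v : W} (hv : v ∈ shiftSet T e) {p : T.Walk e.toProd.1 v} (hp : p.IsPath) :
    ∀ w ∈ p.support, w ∈ shiftSet T e := by
  intro w hw
  rcases (mem_shiftSet_iff hT hp).1 hv with rfl | he
  · rw [(SimpleGraph.Walk.isPath_iff_nil.1 hp).eq_nil] at hw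
    simp only [SimpleGraph.Walk.support_nil, List.mem_singleton] at hw
    exact Or.inl hw
  · obtain ⟨q, rfl⟩ := hp.exists_eq_cons_of_mem_darts he
    rw [SimpleGraph.Walk.support_cons, List.mem_cons] at hw
    rcases hw with hw | hw
    · exact Or.inl hw
    · rw [SimpleGraph.Walk.cons_isPath_iff] at hp
      have hr : (SimpleGraph.Walk.cons e.adj (q.takeUntil w hw)).IsPath :=
        (SimpleGraph.Walk.cons_isPath_iff _ _).2
          ⟨hp.1.takeUntil hw, fun h => hp.2 (q.support_takeUntil_subset_support hw h)⟩
      exact (mem_shiftSet_iff hT hr).2 (Or.inr (by simp))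

theorem not_dartLE_symm {W : Type*} {T : SimpleGraph W} (hT : T.IsTree) {e d : T.Dart}
    (h : dartLE T e d) : ¬ dartLE T e d.symm := by
  intro h'
  obtain ⟨p, hp, -⟩ := hT.existsUnique_path e.toProd.1 d.toProd.1
  obtain ⟨q, hq, -⟩ := hT.existsUnique_path e.toProd.1 d.toProd.2
  have h1 : d.toProd.1 ∈ q.support := q.dart_fst_mem_support_of_mem_darts (h q hq).2
  have h2 : d.toProd.2 ∈ p.support :=
    p.dart_fst_mem_support_of_mem_darts (d := d.symm) (h' p hp).2
  exact hT.isAcyclic.ne_mem_support_of_support_of_adj_of_isPath hp hq d.adj h2 h1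

theorem dartLE_or_dartLE_symm {W : Type*} {T : SimpleGraph W} (hT : T.IsTree) {e d : T.Dart}
    (h1 : d.toProd.1 ∈ shiftSet T e) (h2 : d.toProd.2 ∈ shiftSet T e) :
    dartLE T e d ∨ dartLE T e d.symm := by
  have key : ∀ f : T.Dart, f.toProd.2 ∈ shiftSet T e →
      ∀ p : T.Walk e.toProd.1 f.toProd.1, p.IsPath → f.toProd.2 ∉ p.support →
        dartLE T e f := by
    intro f hf p hp hn
    have hq := hp.concat hn f.adj
    refine (dartLE_iff hT hq).2 ⟨?_, by simp [SimpleGraph.Walk.darts_concat]⟩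
    refine ((mem_shiftSet_iff hT hq).1 hf).resolve_left fun h => hn ?_
    rw [h]
    exact p.start_mem_support
  obtain ⟨p, hp, -⟩ := hT.existsUnique_path e.toProd.1 d.toProd.1
  obtain ⟨q, hq, -⟩ := hT.existsUnique_path e.toProd.1 d.toProd.2
  by_cases h : d.toProd.2 ∈ p.support
  · exact Or.inr (key d.symm h1 q hq
      (hT.isAcyclic.ne_mem_support_of_support_of_adj_of_isPath hp hq d.adj h))
  · exact Or.inl (key d h2 p hp h)

theorem IsStar.le_flip_of_ne_s14 {W V : Type*} [Fintype W] {T : SimpleGraph W}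
    {α : T.Dart → OSep V} {t : W} (h : IsStar (starAt T α t)) {d d' : T.Dart}
    (hd : d.toProd.2 = t) (hd' : d'.toProd.2 = t) (hne : d ≠ d') :
    OSep.le (α d) (α d').flip := by
  refine h _ _ ?_
  have hle : (d ::ₘ {d'} : Multiset T.Dart) ≤
      ((Finset.univ : Finset T.Dart).filter fun d => d.toProd.2 = t).val := by
    rw [Multiset.le_iff_subset (by simpa using hne)]
    intro x hx
    simp only [Multiset.mem_cons, Multiset.mem_singleton] at hx
    rcases hx with rfl | rfl <;> simpa
  simpa [starAt] using Multiset.map_le_map hle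

/-- In a tame tree, labels increase along paths. -/
theorem le_of_mem_darts_cons {W V : Type*} [Fintype W] {T : SimpleGraph W}
    {α : T.Dart → OSep V} (hinv : ∀ d, α d.symm = (α d).flip)
    (htame : ∀ t, IsStar (starAt T α t)) {u v : W} (q : T.Walk u v) :
    ∀ {w : W} (h : T.Adj w u), (SimpleGraph.Walk.cons h q).IsPath →
      ∀ f ∈ (SimpleGraph.Walk.cons h q).darts, OSep.le (α ⟨(w, u), h⟩) (α f) := by
  induction q with
  | nil =>
    intro w h _ f hf
    simp only [SimpleGraph.Walk.darts_cons, SimpleGraph.Walk.darts_nil,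
      List.mem_singleton] at hf
    subst hf
    exact ⟨subset_rfl, subset_rfl⟩
  | @cons a b c h' q ih =>
    intro w h hp f hf
    rw [SimpleGraph.Walk.darts_cons, List.mem_cons] at hf
    rcases hf with rfl | hf
    · exact ⟨subset_rfl, subset_rfl⟩
    · rw [SimpleGraph.Walk.cons_isPath_iff] at hp
      have hwb : w ≠ b := by
        rintro rfl
        exact hp.2 (by simp)
      have h1 := (htame a).le_flip_of_ne_s14 (d := ⟨(w, a), h⟩)
        (d' := (⟨(a, b), h'⟩ : T.Dart).symm) rfl rfl
        (fun hh => hwb (congrArg (fun d : T.Dart => d.toProd.1) hh))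
      rw [hinv] at h1
      have h2 := ih h' hp.1 f hf
      exact ⟨h1.1.trans h2.1, h2.2.trans h1.2⟩

theorem le_of_dartLE {W V : Type*} [Fintype W] {T : SimpleGraph W} (hT : T.IsTree)
    {α : T.Dart → OSep V} (hinv : ∀ d, α d.symm = (α d).flip)
    (htame : ∀ t, IsStar (starAt T α t)) {e f : T.Dart} (h : dartLE T e f) :
    OSep.le (α e) (α f) := by
  obtain ⟨p, hp, -⟩ := hT.existsUnique_path e.toProd.1 f.toProd.2
  obtain ⟨he, hf⟩ := h p hp
  obtain ⟨q, rfl⟩ := hp.exists_eq_cons_of_mem_darts he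
  exact le_of_mem_darts_cons hinv htame q e.adj hp f hf

theorem ord_union_le_of_isLinkedSep {V : Type*} {S : Set (OSep V)} {ord : OSep V → ℕ}
    (hU : IsUniverse S) (hord : IsOrderFun S ord) {a c X : OSep V}
    (hX : IsLinkedSep S ord a X) (hc : c ∈ S) (hac : OSep.le a c) :
    ord (c.union X) ≤ ord c := by
  obtain ⟨hXS, haX, hlam⟩ := hX
  have h1 : lam S ord a X ≤ ord (c.inter X) :=
    Nat.sInf_le ⟨_, ⟨hU.inter_mem c hc X hXS,
      ⟨Set.subset_inter hac.1 haX.1, Set.union_subset hac.2 haX.2⟩,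
      ⟨Set.inter_subset_right, Set.subset_union_right⟩⟩, rfl⟩
  have h2 := hord.submod c hc X hXS
  omega

theorem shiftAlpha_symm {W V : Type*} {T : SimpleGraph W} (hT : T.IsTree)
    (α : T.Dart → OSep V) (e : T.Dart) (X : OSep V) (d : (T.induce (shiftSet T e)).Dart) :
    shiftAlpha T α e X d.symm = (shiftAlpha T α e X d).flip := by
  have hl : liftDart d.symm = (liftDart d).symm := rfl
  simp only [shiftAlpha, hl, SimpleGraph.Dart.symm_symm]
  by_cases h : dartLE T e (liftDart d)
  · rw [if_pos h, if_neg (not_dartLE_symm hT h)]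
  · have h' := (dartLE_or_dartLE_symm hT (d := liftDart d) d.toProd.1.2
      d.toProd.2.2).resolve_left h
    rw [if_neg h, if_pos h']
    rfl

theorem shiftAlpha_mem {W V : Type*} [Fintype W] {T : SimpleGraph W} (hT : T.IsTree)
    {S : Set (OSep V)} {ord : OSep V → ℕ} {k : ℕ} (hU : IsUniverse S)
    (hord : IsOrderFun S ord) {α : T.Dart → OSep V} (hinv : ∀ d, α d.symm = (α d).flip)
    (hrange : ∀ d, α d ∈ S ∧ ord (α d) < k) (htame : ∀ t, IsStar (starAt T α t))
    {e : T.Dart} {X : OSep V} (hX : IsLinkedSep S ord (α e) X)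
    (d : (T.induce (shiftSet T e)).Dart) :
    shiftAlpha T α e X d ∈ S ∧ ord (shiftAlpha T α e X d) < k := by
  have key : ∀ f : T.Dart, dartLE T e f →
      (α f).union X ∈ S ∧ ord ((α f).union X) < k := fun f hf =>
    ⟨hU.union_mem _ (hrange f).1 _ hX.1,
      (ord_union_le_of_isLinkedSep hU hord hX (hrange f).1
        (le_of_dartLE hT hinv htame hf)).trans_lt (hrange f).2⟩
  rw [shiftAlpha]
  split_ifs with h
  · exact key _ h
  · obtain ⟨h1, h2⟩ := key _ ((dartLE_or_dartLE_symm hT (d := liftDart d) d.toProd.1.2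
      d.toProd.2.2).resolve_left h)
    exact ⟨hU.flip_mem _ h1, by rwa [hord.symm _ h1]⟩

/-- The star of the shift at the tail of `e` consists of the single separation `X.flip`. -/
theorem starAt_shiftAlpha_fst {W V : Type*} [Fintype W] {T : SimpleGraph W} (hT : T.IsTree)
    {α : T.Dart → OSep V} {e : T.Dart} {X : OSep V} (hX : OSep.le (α e) X)
    {s : ↥(shiftSet T e)} (hs : (s : W) = e.toProd.1) :
    starAt (T.induce (shiftSet T e)) (shiftAlpha T α e X) s = {X.flip} := by
  obtain ⟨s, hs'⟩ := s
  obtain rfl : s = e.toProd.1 := hs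
  let d₀ : (T.induce (shiftSet T e)).Dart :=
    ⟨(⟨e.toProd.2, snd_mem_shiftSet hT e⟩, ⟨e.toProd.1, hs'⟩), e.adj.symm⟩
  have hmem : ∀ d : (T.induce (shiftSet T e)).Dart,
      d.toProd.2 = ⟨e.toProd.1, hs'⟩ ↔ d = d₀ := by
    intro d
    refine ⟨fun hd => ?_, fun hd => by rw [hd]⟩
    have hadj : T.Adj e.toProd.1 d.toProd.1 := by
      have := (liftDart d).adj.symm
      rwa [show (liftDart d).toProd.2 = e.toProd.1 from congrArg Subtype.val hd] at this
    have hp : (SimpleGraph.Walk.cons hadj SimpleGraph.Walk.nil).IsPath := by simp [hadj.ne]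
    have he := ((mem_shiftSet_iff hT hp).1 d.toProd.1.2).resolve_left hadj.ne'
    simp only [SimpleGraph.Walk.darts_cons, SimpleGraph.Walk.darts_nil,
      List.mem_singleton] at he
    have he2 : e.toProd.2 = d.toProd.1 := congrArg (fun d : T.Dart => d.toProd.2) he
    exact SimpleGraph.Dart.ext _ _ (Prod.ext (Subtype.ext he2.symm) hd)
  have hnot : ¬ dartLE T e (liftDart d₀) := fun h =>
    List.not_mem_nil (h SimpleGraph.Walk.nil SimpleGraph.Walk.IsPath.nil).1
  have hval : shiftAlpha T α e X d₀ = X.flip := by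
    rw [shiftAlpha, if_neg hnot]
    change ((α e).union X).flip = X.flip
    simp [OSep.union, OSep.flip, Set.union_eq_right.2 hX.1, Set.inter_eq_right.2 hX.2]
  have hmap : ∀ D : Finset (T.induce (shiftSet T e)).Dart, D = {d₀} →
      D.val.map (shiftAlpha T α e X) = {X.flip} := by
    rintro _ rfl
    rw [Finset.singleton_val, Multiset.map_singleton, hval]
  refine hmap _ (Finset.ext fun d => ?_)
  simp only [Finset.mem_filter, Finset.mem_univ, true_and, Finset.mem_singleton, hmem]

theorem isStar_singleton {V : Type*} (a : OSep V) : IsStar {a} := by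
  intro b c h
  simpa using Multiset.card_le_card h

/-- Lemma `l:closedundershifting`. If `F` is fixed under shifting,
`(T,α)` is a tame `S_k`-tree with `α(F⃗_s) ∈ F` for every vertex `s ≠ t` of `T(e⃗)`, where
`e⃗ = (t,t')`, and `(X,Y)` is linked to `α(e⃗)`, then the shift of `(T,α)` onto `(X,Y)` with
respect to `e⃗` is a tame `S_k`-tree over `F ∪ {{(Y,X)}}`; if moreover `{(Y,X)} ∉ F`, then
`t` is the unique vertex of `T(e⃗)` whose star is `{(Y,X)}`. -/
theorem shift_over_family {V : Type*} [Fintype V] (S : Set (OSep V)) (ord : OSep V → ℕ)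
    (k : ℕ) (hU : IsUniverse S) (hord : IsOrderFun S ord)
    (F : Set (Multiset (OSep V))) (hFstar : ∀ σ ∈ F, IsStar σ)
    (hfix : FixedUnderShifting S ord F)
    (n : ℕ) (T : SimpleGraph (Fin n)) (hT : T.IsTree) (α : T.Dart → OSep V)
    (hinv : ∀ d, α d.symm = (α d).flip) (hrange : ∀ d, α d ∈ S ∧ ord (α d) < k)
    (htame : ∀ t, IsStar (starAt T α t))
    (e : T.Dart)
    (hF : ∀ s : ↥(shiftSet T e), (s : Fin n) ≠ e.toProd.1 → starAt T α (s : Fin n) ∈ F)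
    (X : OSep V) (hlinked : IsLinkedSep S ord (α e) X) :
    (T.induce (shiftSet T e)).IsTree ∧
    (∀ d, shiftAlpha T α e X d.symm = (shiftAlpha T α e X d).flip) ∧
    (∀ d, shiftAlpha T α e X d ∈ S ∧ ord (shiftAlpha T α e X d) < k) ∧
    (∀ s, IsStar (starAt (T.induce (shiftSet T e)) (shiftAlpha T α e X) s)) ∧
    (∀ s, starAt (T.induce (shiftSet T e)) (shiftAlpha T α e X) s ∈
      F ∪ {({X.flip} : Multiset (OSep V))}) ∧
    (({X.flip} : Multiset (OSep V)) ∉ F →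
      ∀ s : ↥(shiftSet T e),
        starAt (T.induce (shiftSet T e)) (shiftAlpha T α e X) s = {X.flip} ↔
          (s : Fin n) = e.toProd.1) := by
  have hout : ∀ s : ↥(shiftSet T e), (s : Fin n) ≠ e.toProd.1 →
      starAt (T.induce (shiftSet T e)) (shiftAlpha T α e X) s ∈ F := fun s hs =>
    hfix n T α e X s hT hinv (fun d => (hrange d).1) htame hs (hF s hs) hlinked
  have hin : ∀ s : ↥(shiftSet T e), (s : Fin n) = e.toProd.1 →
      starAt (T.induce (shiftSet T e)) (shiftAlpha T α e X) s = {X.flip} := fun s hs =>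
    starAt_shiftAlpha_fst hT hlinked.2.1 hs
  refine ⟨isTree_induce_shiftSet hT e, shiftAlpha_symm hT α e X,
    shiftAlpha_mem hT hU hord hinv hrange htame hlinked, fun s => ?_, fun s => ?_,
    fun hX s => ⟨fun h => ?_, hin s⟩⟩
  · by_cases hs : (s : Fin n) = e.toProd.1
    · rw [hin s hs]
      exact isStar_singleton _
    · exact hFstar _ (hout s hs)
  · by_cases hs : (s : Fin n) = e.toProd.1
    · exact Or.inr (hin s hs)
    · exact Or.inl (hout s hs)
  · by_contra hs
    exact hX (h ▸ hout s hs)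
end
end
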